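/- Let a group G act without inversion on locally finite pocsets P and P', let f₀ : P → P' be a G-equivariant resolution, and let φ : P → P/∼ be an elementary fold of f₀. Then the induced map f₁ : P/∼ → P' determined by f₀ = f₁ ∘ φ is admissible, and the map [h]_{∼_{f₁}} ↦ [h]_{∼_{f₀}} is an isomorphism of pocsets from (P/∼)/∼_{f₁} onto P/∼_{f₀}. In particular f₁ is a G-equivariant resolution. -/

import Mathlib

/- Pocsets, hyperplanes, admissible equivalence relations, quotients,
   admissible maps, embeddings, resolutions, group actions on pocsets,
   elementary folds and folding sequences. -/

universe u v w

/-- A pocset: a poset with an order-reversing involution `star` such that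
`h ≠ h *` and `h`, `h *` are incomparable. -/
structure Pocset (P : Type u) where
  le : P → P → Prop
  star : P → P
  le_refl : ∀ a, le a a
  le_trans : ∀ {a b c}, le a b → le b c → le a c
  le_antisymm : ∀ {a b}, le a b → le b a → a = b
  star_star : ∀ a, star (star a) = a
  star_antitone : ∀ {a b}, le a b → le (star b) (star a)
  ne_star : ∀ a, a ≠ star a
  not_le_star : ∀ a, ¬ le a (star a)
  not_star_le : ∀ a, ¬ le (star a) a

namespace Pocset

variable {P : Type u} {P' : Type v}

/-- Strict order. -/
def lt (Q : Pocset P) (a b : P) : Prop := Q.le a b ∧ a ≠ b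

/-- The orientations of the hyperplane `ĥ` determined by the halfspace `h`. -/
def orient (Q : Pocset P) (h : P) : Set P := {h, Q.star h}

/-- `k` is an orientation of the same hyperplane as `h`, i.e. `k̂ = ĥ`. -/
def sameHyp (Q : Pocset P) (h k : P) : Prop := k = h ∨ k = Q.star h

/-- The hyperplanes `ĥ` and `k̂` are transverse: they are distinct and no
orientation of `ĥ` is comparable with any orientation of `k̂`. -/
def transverse (Q : Pocset P) (h k : P) : Prop :=
  ¬ Q.sameHyp h k ∧ ∀ a ∈ Q.orient h, ∀ b ∈ Q.orient k, ¬ Q.le a b ∧ ¬ Q.le b a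

/-- Two hyperplanes are disjoint if they are distinct and not transverse. -/
def disjointHyp (Q : Pocset P) (h k : P) : Prop :=
  ¬ Q.sameHyp h k ∧ ¬ Q.transverse h k

/-- The halfspaces `h` and `k` are facing: `h* < k`. -/
def facing (Q : Pocset P) (h k : P) : Prop := Q.lt (Q.star h) k

/-- The halfspaces `h` and `k` are compatible: not `k ≤ h*`. -/
def compatible (Q : Pocset P) (h k : P) : Prop := ¬ Q.le k (Q.star h)

/-- The hyperplane `k̂` separates the hyperplanes `ĥ` and `l̂`: there are
orientations with `a < b < c`. -/
def separates (Q : Pocset P) (k h l : P) : Prop :=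
  ∃ a ∈ Q.orient h, ∃ b ∈ Q.orient k, ∃ c ∈ Q.orient l, Q.lt a b ∧ Q.lt b c

/-- Local finiteness: every interval is finite. -/
def LocallyFinite (Q : Pocset P) : Prop :=
  ∀ a b : P, {c : P | Q.le a c ∧ Q.le c b}.Finite

/-- The equivalence relation induced on hyperplanes by a relation `r` on
halfspaces: `ĥ ∼ k̂` iff `h ∼ k` or `h ∼ k*`. -/
def hypRel (Q : Pocset P) (r : P → P → Prop) (h k : P) : Prop :=
  r h k ∨ r h (Q.star k)

/-- An admissible equivalence relation on a pocset. -/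
structure IsAdmissible (Q : Pocset P) (r : P → P → Prop) : Prop where
  equiv : Equivalence r
  aer1 : ∀ h, ¬ r h (Q.star h)
  aer2 : ∀ h k, r h k → r (Q.star h) (Q.star k)
  aer3 : ∀ h k, Q.transverse h k → ¬ r h k
  aer4 : ∀ h k, Q.hypRel r h k → ¬ Q.sameHyp h k →
    (∀ m, Q.hypRel r h m → ¬ Q.separates m h k) →
    ∀ a ∈ Q.orient h, ∀ b ∈ Q.orient k, Q.facing a b → r a b

/-- The strict quotient relation: `[h] < [k]` iff `[h] ≠ [k]`, every pair of
representatives has disjoint hyperplanes, and `h' < k'` for every pair of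
representatives whose hyperplanes are `([ĥ] ∪ [k̂])`-inseparable. -/
def QuotLT (Q : Pocset P) (r : P → P → Prop) (h k : P) : Prop :=
  ¬ r h k ∧
  (∀ h' k', r h h' → r k k' → Q.disjointHyp h' k') ∧
  (∀ h' k', r h h' → r k k' →
    (∀ m, (Q.hypRel r h m ∨ Q.hypRel r k m) → ¬ Q.separates m h' k') → Q.lt h' k')

/-- The quotient relation: `[h] ≤ [k]` iff `[h] = [k]` or `[h] < [k]`. -/
def QuotLE (Q : Pocset P) (r : P → P → Prop) (h k : P) : Prop :=
  r h k ∨ Q.QuotLT r h k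

/-- Transversality of `[ĥ]` and `[k̂]` in the quotient pocset. -/
def QuotTransverse (Q : Pocset P) (r : P → P → Prop) (h k : P) : Prop :=
  ¬ Q.hypRel r h k ∧
  ∀ a ∈ Q.orient h, ∀ b ∈ Q.orient k, ¬ Q.QuotLE r a b ∧ ¬ Q.QuotLE r b a

/-- `[k̂]` separates `[ĥ]` and `[l̂]` in the quotient pocset. -/
def QuotSeparates (Q : Pocset P) (r : P → P → Prop) (k h l : P) : Prop :=
  ∃ a ∈ Q.orient h, ∃ b ∈ Q.orient k, ∃ c ∈ Q.orient l,
    Q.QuotLT r a b ∧ Q.QuotLT r b c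

/-- `[h]` and `[k]` are facing in the quotient pocset: `[h]* < [k]`. -/
def QuotFacing (Q : Pocset P) (r : P → P → Prop) (h k : P) : Prop :=
  Q.QuotLT r (Q.star h) k

/-- An admissible map of pocsets. -/
structure IsAdmissibleMap (Q : Pocset P) (Q' : Pocset P') (f : P → P') : Prop where
  am1 : ∀ h, f (Q.star h) = Q'.star (f h)
  am2 : ∀ h k, Q.transverse h k → Q'.transverse (f h) (f k)
  am3 : ∀ h k, Q.facing h k → Q'.sameHyp (f h) (f k) →
    (∀ m, Q'.sameHyp (f m) (f h) → ¬ Q.separates m h k) → f h = f k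
  am4 : ∀ h' : P', (∀ m : P, ¬ Q'.sameHyp (f m) h') →
    ∃ b ∈ Q'.orient h', ∀ m : P, Q'.compatible b (f m)

/-- An embedding of pocsets: an injective, order-reflecting admissible map. -/
structure IsPocsetEmbedding (Q : Pocset P) (Q' : Pocset P') (f : P → P') : Prop where
  adm : IsAdmissibleMap Q Q' f
  inj : Function.Injective f
  le_reflect : ∀ h k, Q'.le (f h) (f k) → Q.le h k

/-- The equivalence relation `∼_f` induced by a map `f`. -/
def simRel (f : P → P') : P → P → Prop := fun a b => f a = f b

/-- A resolution of pocsets: an admissible map `f` such that `∼_f` is an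
admissible equivalence relation and the induced map `P/∼_f → P'` is an
embedding of pocsets (stated here on representatives: `quot_am2` and
`quot_am3` are admissibility of the induced map, `le_reflect` is
order-reflection; injectivity of the induced map is automatic, and its
properties (AM1) and (AM4) coincide with those of `f`). -/
structure IsResolution (Q : Pocset P) (Q' : Pocset P') (f : P → P') : Prop where
  adm : IsAdmissibleMap Q Q' f
  aer : Q.IsAdmissible (simRel f)
  quot_am2 : ∀ h k, Q.QuotTransverse (simRel f) h k → Q'.transverse (f h) (f k)
  quot_am3 : ∀ h k, Q.QuotFacing (simRel f) h k → Q'.sameHyp (f h) (f k) →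
    (∀ m, Q'.sameHyp (f m) (f h) → ¬ Q.QuotSeparates (simRel f) m h k) → f h = f k
  le_reflect : ∀ h k, Q'.le (f h) (f k) → Q.QuotLE (simRel f) h k

/-- A group `G` acts (without inversion) on the pocset `Q` by order-preserving
bijections commuting with `star`. -/
structure IsGAction (Q : Pocset P) (G : Type w) [Group G] [MulAction G P] : Prop where
  smul_le : ∀ (g : G) (a b : P), Q.le a b → Q.le (g • a) (g • b)
  smul_star : ∀ (g : G) (a : P), g • Q.star a = Q.star (g • a)
  no_inversion : ∀ (g : G) (a : P), g • a ≠ Q.star a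

/-- `G`-equivariance of a map. -/
def Equivariant (G : Type w) [Group G] [MulAction G P] [MulAction G P']
    (f : P → P') : Prop :=
  ∀ (g : G) (a : P), f (g • a) = g • f a

/-- An elementary foldable pair for a resolution `f`: facing halfspaces with
`f h₁ = f h₂`, whose hyperplanes are `f⁻¹(f(ĥ₁))`-inseparable, such that no
pair of distinct `∼_f`-equivalent hyperplanes both separate `ĥ₁` and `ĥ₂`. -/
def ElemFoldable (Q : Pocset P) (Q' : Pocset P') (f : P → P') (h₁ h₂ : P) : Prop :=
  Q.facing h₁ h₂ ∧ f h₁ = f h₂ ∧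
  (∀ m, Q'.sameHyp (f m) (f h₁) → ¬ Q.separates m h₁ h₂) ∧
  (∀ m m', Q'.sameHyp (f m) (f m') → ¬ Q.sameHyp m m' →
    ¬ (Q.separates m h₁ h₂ ∧ Q.separates m' h₁ h₂))

/-- `r` is the smallest `G`-invariant and `star`-invariant equivalence
relation with `h₁ ∼ h₂`. -/
structure IsFoldRel (Q : Pocset P) (G : Type w) [Group G] [MulAction G P]
    (h₁ h₂ : P) (r : P → P → Prop) : Prop where
  equiv : Equivalence r
  ginv : ∀ (g : G) (a b : P), r a b → r (g • a) (g • b)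
  sinv : ∀ a b, r a b → r (Q.star a) (Q.star b)
  base : r h₁ h₂
  min : ∀ s : P → P → Prop, Equivalence s →
    (∀ (g : G) (a b : P), s a b → s (g • a) (g • b)) →
    (∀ a b, s a b → s (Q.star a) (Q.star b)) → s h₁ h₂ →
    ∀ a b, r a b → s a b

/-- `[h₁]`, `[h₂]` is an elementary foldable pair in the quotient pocset
`P/r` for the resolution induced by `f` on `P/r`. -/
def QuotElemFoldable (Q : Pocset P) (Q' : Pocset P') (f : P → P')
    (r : P → P → Prop) (h₁ h₂ : P) : Prop :=
  Q.QuotFacing r h₁ h₂ ∧ f h₁ = f h₂ ∧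
  (∀ m, Q'.sameHyp (f m) (f h₁) → ¬ Q.QuotSeparates r m h₁ h₂) ∧
  (∀ m m', Q'.sameHyp (f m) (f m') → ¬ Q.hypRel r m m' →
    ¬ (Q.QuotSeparates r m h₁ h₂ ∧ Q.QuotSeparates r m' h₁ h₂))

/-- `r'` is (the pullback to `P` of) the smallest `G`-invariant and
`star`-invariant equivalence relation on `P/r` identifying `[h₁] ∼ [h₂]`,
i.e. the smallest `G`-invariant, `star`-invariant equivalence relation on `P`
containing `r` with `h₁ ∼ h₂`. -/
structure IsFoldStepRel (Q : Pocset P) (G : Type w) [Group G] [MulAction G P]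
    (r : P → P → Prop) (h₁ h₂ : P) (r' : P → P → Prop) : Prop where
  equiv : Equivalence r'
  mono : ∀ a b, r a b → r' a b
  ginv : ∀ (g : G) (a b : P), r' a b → r' (g • a) (g • b)
  sinv : ∀ a b, r' a b → r' (Q.star a) (Q.star b)
  base : r' h₁ h₂
  min : ∀ s : P → P → Prop, Equivalence s → (∀ a b, r a b → s a b) →
    (∀ (g : G) (a b : P), s a b → s (g • a) (g • b)) →
    (∀ a b, s a b → s (Q.star a) (Q.star b)) → s h₁ h₂ →
    ∀ a b, r' a b → s a b

/-- A finite folding sequence `P = P₀ ↝ P₁ ↝ ⋯ ↝ Pₙ` for a `G`-equivariant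
resolution `f : P → P'`, encoded by the sequence of equivalence relations
`rs i` on `P` with `Pᵢ = P / rs i`: `rs 0` is equality, every `rs i` refines
`∼_f`, and each step is an elementary fold (of an elementary foldable pair
for the induced resolution `fᵢ : P/rs i → P'`). -/
def IsFoldingSequence (Q : Pocset P) (Q' : Pocset P') (G : Type w) [Group G]
    [MulAction G P] (f : P → P') (n : ℕ)
    (rs : Fin (n + 1) → (P → P → Prop)) : Prop :=
  (∀ a b : P, rs 0 a b ↔ a = b) ∧
  (∀ (i : Fin (n + 1)) (a b : P), rs i a b → f a = f b) ∧
  (∀ i : Fin n, ∃ h₁ h₂ : P,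
    Q.QuotElemFoldable Q' f (rs i.castSucc) h₁ h₂ ∧
    Q.IsFoldStepRel G (rs i.castSucc) h₁ h₂ (rs i.succ))

end Pocset

namespace Pocset

variable {P : Type u} {P' : Type v} {Q : Pocset P} {Q' : Pocset P'} {r : P → P → Prop}

/-! ### Order and separation -/

theorem lt_trans {a b c : P} (h : Q.lt a b) (h' : Q.lt b c) : Q.lt a c := by
  refine ⟨Q.le_trans h.1 h'.1, ?_⟩
  rintro rfl
  exact h.2 (Q.le_antisymm h.1 h'.1)

theorem lt_of_lt_of_le {a b c : P} (h : Q.lt a b) (h' : Q.le b c) : Q.lt a c := by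
  refine ⟨Q.le_trans h.1 h', ?_⟩
  rintro rfl
  exact h.2 (Q.le_antisymm h.1 h')

theorem lt_of_le_of_lt {a b c : P} (h : Q.le a b) (h' : Q.lt b c) : Q.lt a c := by
  refine ⟨Q.le_trans h h'.1, ?_⟩
  rintro rfl
  exact h'.2 (Q.le_antisymm h'.1 h)

theorem lt_irrefl (a : P) : ¬ Q.lt a a := fun h => h.2 rfl

theorem lt_asymm {a b : P} (h : Q.lt a b) : ¬ Q.lt b a := fun h' => lt_irrefl a (lt_trans h h')

theorem not_lt_star (a : P) : ¬ Q.lt a (Q.star a) := fun h => Q.not_le_star a h.1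

theorem not_star_lt (a : P) : ¬ Q.lt (Q.star a) a := fun h => Q.not_star_le a h.1

theorem lt_star_star {a b : P} (h : Q.lt a b) : Q.lt (Q.star b) (Q.star a) :=
  ⟨Q.star_antitone h.1, fun e => h.2 (by rw [← Q.star_star a, ← e, Q.star_star])⟩

theorem lt_star_comm {a b : P} (h : Q.lt a (Q.star b)) : Q.lt b (Q.star a) := by
  simpa [Q.star_star] using lt_star_star h

theorem star_lt_comm {a b : P} (h : Q.lt (Q.star a) b) : Q.lt (Q.star b) a := by
  simpa [Q.star_star] using lt_star_star h

theorem lt_of_star {a b : P} (h : Q.lt (Q.star b) (Q.star a)) : Q.lt a b := by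
  simpa [Q.star_star] using lt_star_star h

theorem mem_orient {h a : P} : a ∈ Q.orient h ↔ a = h ∨ a = Q.star h := Iff.rfl

theorem mem_orient_self (h : P) : h ∈ Q.orient h := Or.inl rfl

theorem star_mem_orient {h a : P} (ha : a ∈ Q.orient h) : Q.star a ∈ Q.orient h := by
  rcases ha with rfl | rfl
  · exact Or.inr rfl
  · exact Or.inl (Q.star_star h)

/-- At most one pair of orientations `x`, `y` of two given hyperplanes satisfies `x < y` up to
passing to `y* < x*`. -/
theorem orient_eq_of_lt {a b x y : P} (h : Q.lt a b) (hxy : Q.lt x y)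
    (hx : x ∈ Q.orient a) (hy : y ∈ Q.orient b) : x = a ∧ y = b := by
  rw [mem_orient] at hx hy
  grind [→ lt_trans, → lt_star_star, not_lt_star, not_star_lt, lt_irrefl, Q.star_star]

/-- The hyperplane of `x` lies strictly inside one side of `a`: some orientation of it is above
`a`. -/
def above (Q : Pocset P) (a x : P) : Prop := Q.lt a x ∨ Q.lt a (Q.star x)

theorem above_star_right {a x : P} : Q.above a (Q.star x) ↔ Q.above a x := by
  simp only [above, Q.star_star]
  exact or_comm

theorem not_above_star {a x : P} (h : Q.above a x) : ¬ Q.above (Q.star a) x := by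
  unfold above at *
  grind [→ lt_trans, → lt_star_star, not_lt_star, not_star_lt, lt_irrefl, Q.star_star]

theorem lt_iff_above {a b : P} : Q.lt a b ↔ Q.above a b ∧ Q.above (Q.star b) a := by
  unfold above
  grind [→ lt_trans, → lt_star_star, not_lt_star, not_star_lt, lt_irrefl, Q.star_star]

theorem above_or_above_of_above {a x : P} (h : Q.above a x) :
    Q.above x a ∨ Q.above (Q.star x) a := by
  unfold above at *
  grind [→ lt_trans, → lt_star_star, not_lt_star, not_star_lt, lt_irrefl, Q.star_star]

theorem separates_iff {m h l : P} : Q.separates m h l ↔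
    (Q.above m h ∧ Q.above (Q.star m) l) ∨ (Q.above (Q.star m) h ∧ Q.above m l) := by
  unfold separates above
  simp only [mem_orient, exists_eq_or_imp, exists_eq_left]
  grind [→ lt_trans, → lt_star_star, not_lt_star, not_star_lt, lt_irrefl, Q.star_star]

theorem disjointHyp_iff {a x : P} : Q.disjointHyp a x ↔ Q.above a x ∨ Q.above (Q.star a) x := by
  unfold disjointHyp transverse sameHyp above
  simp only [mem_orient, forall_eq_or_imp, forall_eq, lt]
  grind [Q.star_star, → Q.star_antitone, Q.le_refl, Q.not_le_star, Q.not_star_le]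

theorem orient_congr {x y : P} (h : x ∈ Q.orient y) : Q.orient x = Q.orient y := by
  rcases h with rfl | rfl
  · rfl
  · simp only [orient, Q.star_star, Set.pair_comm]

theorem mem_orient_comm {x y : P} (h : x ∈ Q.orient y) : y ∈ Q.orient x := by
  rw [orient_congr h]
  exact mem_orient_self y

theorem separates_congr {m m' h h' l l' : P} (hm : m' ∈ Q.orient m) (hh : h' ∈ Q.orient h)
    (hl : l' ∈ Q.orient l) : Q.separates m' h' l' ↔ Q.separates m h l := by
  simp only [separates, orient_congr hm, orient_congr hh, orient_congr hl]

theorem disjointHyp_iff_lt {a b : P} :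
    Q.disjointHyp a b ↔ ∃ x ∈ Q.orient a, ∃ y ∈ Q.orient b, Q.lt x y := by
  simp only [disjointHyp_iff, above, mem_orient, exists_eq_or_imp, exists_eq_left]

theorem separates_of_lt {x m y : P} (h : Q.lt x m) (h' : Q.lt m y) : Q.separates m x y :=
  ⟨x, mem_orient_self x, m, mem_orient_self m, y, mem_orient_self y, h, h'⟩

theorem separates_comm {m h l : P} (hs : Q.separates m h l) : Q.separates m l h := by
  rw [separates_iff] at *
  tauto

theorem disjointHyp_of_separates {m h l : P} (hs : Q.separates m h l) : Q.disjointHyp h l := by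
  obtain ⟨a, ha, b, -, c, hc, hab, hbc⟩ := hs
  exact disjointHyp_iff_lt.2 ⟨a, ha, c, hc, lt_trans hab hbc⟩

theorem exists_lt_lt_of_separates {m x y : P} (hxy : Q.lt x y) (hs : Q.separates m x y) :
    ∃ m' ∈ Q.orient m, Q.lt x m' ∧ Q.lt m' y := by
  obtain ⟨a, ha, b, hb, c, hc, hab, hbc⟩ := hs
  obtain ⟨rfl, rfl⟩ := orient_eq_of_lt hxy (lt_trans hab hbc) ha hc
  exact ⟨b, hb, hab, hbc⟩

theorem disjointHyp_comm {a b : P} (h : Q.disjointHyp a b) : Q.disjointHyp b a := by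
  rw [disjointHyp_iff] at *
  rcases h with h | h
  · exact above_or_above_of_above h
  · rcases above_or_above_of_above h with h | h
    · exact Or.inl (above_star_right.1 h)
    · exact Or.inr (above_star_right.1 h)

theorem disjointHyp_congr {a b a' b' : P} (ha : a' ∈ Q.orient a) (hb : b' ∈ Q.orient b) :
    Q.disjointHyp a' b' ↔ Q.disjointHyp a b := by
  simp only [disjointHyp_iff_lt, orient_congr ha, orient_congr hb]

/-- Disjoint halfspaces between two given ones are comparable. -/
theorem lt_or_lt_of_disjointHyp {a b x y : P} (hd : Q.disjointHyp a b) (hxa : Q.lt x a)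
    (hxb : Q.lt x b) (hay : Q.lt a y) (hby : Q.lt b y) : Q.lt a b ∨ Q.lt b a := by
  obtain ⟨p, hp, q, hq, hpq⟩ := disjointHyp_iff_lt.1 hd
  rw [mem_orient] at hp hq
  grind [→ lt_trans, → lt_star_star, not_lt_star, not_star_lt, lt_irrefl, Q.star_star]

/-- A nonempty set of halfspaces in an interval has a minimal element. -/
theorem LocallyFinite.exists_minimal (hLF : Q.LocallyFinite) {S : P → Prop} {x e : P} (he : S e)
    (hxe : Q.lt x e) :
    ∃ c, S c ∧ Q.lt x c ∧ Q.le c e ∧ ∀ d, S d → Q.lt x d → ¬ Q.lt d c := by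
  induction hn : {c | Q.le x c ∧ Q.le c e}.ncard using Nat.strong_induction_on generalizing e with
  | _ n ih =>
    by_cases h : ∃ d, S d ∧ Q.lt x d ∧ Q.lt d e
    · obtain ⟨d, hd, hxd, hde⟩ := h
      have hlt : {c | Q.le x c ∧ Q.le c d}.ncard < n := by
        rw [← hn]
        refine Set.ncard_lt_ncard ⟨fun c hc => ⟨hc.1, Q.le_trans hc.2 hde.1⟩, fun hsub => ?_⟩
          (hLF x e)
        exact hde.2 (Q.le_antisymm hde.1 (hsub ⟨hxe.1, Q.le_refl e⟩).2)
      obtain ⟨c, hc, hxc, hcd, hmin⟩ := ih _ hlt hd hxd rfl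
      exact ⟨c, hc, hxc, Q.le_trans hcd hde.1, hmin⟩
    · exact ⟨e, he, hxe, Q.le_refl e, fun d hd hxd hde => h ⟨d, hd, hxd, hde⟩⟩

/-- A nonempty set of halfspaces in an interval has a maximal element. -/
theorem LocallyFinite.exists_maximal (hLF : Q.LocallyFinite) {S : P → Prop} {y e : P} (he : S e)
    (hey : Q.lt e y) :
    ∃ c, S c ∧ Q.lt c y ∧ Q.le e c ∧ ∀ d, S d → Q.lt d y → ¬ Q.lt c d := by
  obtain ⟨c, hc, hyc, hce, hmin⟩ := hLF.exists_minimal (S := fun c => S (Q.star c))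
    (x := Q.star y) (e := Q.star e) (by simpa [Q.star_star] using he) (lt_star_star hey)
  refine ⟨Q.star c, hc, star_lt_comm hyc, ?_, fun d hd hdy hcd => ?_⟩
  · simpa [Q.star_star] using Q.star_antitone hce
  · exact hmin (Q.star d) (by simpa [Q.star_star] using hd) (lt_star_star hdy) (star_lt_comm hcd)

/-! ### The relation on hyperplanes -/

theorem hypRel.exists_mem_orient {h k : P} (e : Q.hypRel r h k) :
    ∃ k' ∈ Q.orient k, r h k' := by
  rcases e with e | e
  exacts [⟨k, Or.inl rfl, e⟩, ⟨_, Or.inr rfl, e⟩]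

namespace IsAdmissible

theorem hypRel_refl (hr : Q.IsAdmissible r) (h : P) : Q.hypRel r h h := Or.inl (hr.equiv.refl h)

theorem rel_star_iff (hr : Q.IsAdmissible r) {h k : P} : r (Q.star h) k ↔ r h (Q.star k) := by
  constructor <;> intro e <;> simpa [Q.star_star] using hr.aer2 _ _ e

theorem hypRel_symm (hr : Q.IsAdmissible r) {h k : P} (e : Q.hypRel r h k) : Q.hypRel r k h :=
  e.imp hr.equiv.symm fun e => hr.rel_star_iff.1 (hr.equiv.symm e)

theorem hypRel_trans (hr : Q.IsAdmissible r) {h k l : P} (e : Q.hypRel r h k)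
    (e' : Q.hypRel r k l) : Q.hypRel r h l := by
  rcases e with e | e <;> rcases e' with e' | e'
  · exact Or.inl (hr.equiv.trans e e')
  · exact Or.inr (hr.equiv.trans e e')
  · exact Or.inr (hr.equiv.trans e (hr.aer2 _ _ e'))
  · exact Or.inl (hr.equiv.trans e (Q.star_star l ▸ hr.aer2 _ _ e'))

theorem hypRel_of_mem_orient (hr : Q.IsAdmissible r) {h k : P} (e : k ∈ Q.orient h) :
    Q.hypRel r h k := by
  rcases e with rfl | rfl
  · exact hr.hypRel_refl _
  · exact Or.inr (by rw [Q.star_star]; exact hr.equiv.refl _)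

theorem disjointHyp_of_rel (hr : Q.IsAdmissible r) {h k : P} (e : r h k) (hne : h ≠ k) :
    Q.disjointHyp h k := by
  refine ⟨?_, fun ht => hr.aer3 _ _ ht e⟩
  rintro (rfl | rfl)
  exacts [hne rfl, hr.aer1 _ e]

end IsAdmissible

/-! ### The quotient order -/

/-- No hyperplane in the classes of `h` and `k` separates `h` and `k`. -/
def Insep (Q : Pocset P) (r : P → P → Prop) (h k : P) : Prop :=
  ∀ m, (Q.hypRel r h m ∨ Q.hypRel r k m) → ¬ Q.separates m h k

theorem insep_of_lt {x y : P} (hxy : Q.lt x y)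
    (hx : ∀ z, Q.hypRel r x z → Q.lt x z → ¬ Q.lt z y)
    (hy : ∀ z, Q.hypRel r y z → Q.lt x z → ¬ Q.lt z y) (hr : Q.IsAdmissible r) :
    Q.Insep r x y := by
  intro m hm hs
  obtain ⟨m', hm', h1, h2⟩ := exists_lt_lt_of_separates hxy hs
  have e := hr.hypRel_of_mem_orient hm'
  exact hm.elim (fun hm => hx m' (hr.hypRel_trans hm e) h1 h2)
    (fun hm => hy m' (hr.hypRel_trans hm e) h1 h2)

theorem insep_symm {h k : P} (hi : Q.Insep r h k) : Q.Insep r k h :=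
  fun m hm hs => hi m hm.symm (separates_comm hs)

namespace IsAdmissible

theorem insep_congr (hr : Q.IsAdmissible r) {h k h' k' : P} (hh : h' ∈ Q.orient h)
    (hk : k' ∈ Q.orient k) (hi : Q.Insep r h k) : Q.Insep r h' k' := by
  intro m hm hs
  rw [separates_congr (mem_orient_self m) hh hk] at hs
  exact hi m (hm.imp (hr.hypRel_trans (hr.hypRel_of_mem_orient hh))
    (hr.hypRel_trans (hr.hypRel_of_mem_orient hk))) hs

theorem quotLT_congr (hr : Q.IsAdmissible r) {h k h' k' : P} (hlt : Q.QuotLT r h k)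
    (hh : r h h') (hk : r k k') : Q.QuotLT r h' k' := by
  refine ⟨fun e => hlt.1 (hr.equiv.trans hh (hr.equiv.trans e (hr.equiv.symm hk))),
    fun a b ha hb => hlt.2.1 a b (hr.equiv.trans hh ha) (hr.equiv.trans hk hb),
    fun a b ha hb hs => hlt.2.2 a b (hr.equiv.trans hh ha) (hr.equiv.trans hk hb)
      fun m hm => hs m (hm.imp (hr.hypRel_trans (Or.inl (hr.equiv.symm hh)))
        (hr.hypRel_trans (Or.inl (hr.equiv.symm hk))))⟩

theorem lt_of_quotLT (hr : Q.IsAdmissible r) {h k : P} (hlt : Q.QuotLT r h k)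
    (hi : Q.Insep r h k) : Q.lt h k :=
  hlt.2.2 h k (hr.equiv.refl h) (hr.equiv.refl k) hi

theorem disjointHyp_of_quotLT (hr : Q.IsAdmissible r) {h k : P} (hlt : Q.QuotLT r h k) :
    Q.disjointHyp h k :=
  hlt.2.1 h k (hr.equiv.refl h) (hr.equiv.refl k)

theorem quotLT_of_forall (hr : Q.IsAdmissible r) {h k : P} (hne : ¬ r h k)
    (hd : ∀ h' k', r h h' → r k k' → Q.disjointHyp h' k')
    (hlt : ∀ h' k', r h h' → r k k' → Q.Insep r h' k' → Q.lt h' k') : Q.QuotLT r h k :=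
  ⟨hne, hd, fun h' k' hh hk hs => hlt h' k' hh hk fun m hm =>
    hs m (hm.imp (hr.hypRel_trans (Or.inl hh)) (hr.hypRel_trans (Or.inl hk)))⟩

theorem quotLT_star_star (hr : Q.IsAdmissible r) {h k : P} (hlt : Q.QuotLT r h k) :
    Q.QuotLT r (Q.star k) (Q.star h) := by
  refine hr.quotLT_of_forall (fun e => hlt.1 ?_) (fun a b ha hb => ?_) (fun a b ha hb hi => ?_)
  · simpa [Q.star_star] using hr.aer2 _ _ (hr.equiv.symm e)
  · rw [← disjointHyp_congr (star_mem_orient (mem_orient_self a))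
      (star_mem_orient (mem_orient_self b))]
    exact disjointHyp_comm (hlt.2.1 _ _ (hr.rel_star_iff.1 hb) (hr.rel_star_iff.1 ha))
  · refine lt_of_star (hr.lt_of_quotLT (hr.quotLT_congr hlt (hr.rel_star_iff.1 hb)
      (hr.rel_star_iff.1 ha)) ?_)
    exact hr.insep_congr (star_mem_orient (mem_orient_self b)) (star_mem_orient (mem_orient_self a))
      (insep_symm hi)

/-- Between two nested halfspaces there is a nested inseparable pair in their classes. -/
theorem exists_insep (hr : Q.IsAdmissible r) (hLF : Q.LocallyFinite) {x y : P} (hxy : Q.lt x y) :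
    ∃ x' y', Q.hypRel r x x' ∧ Q.hypRel r y y' ∧ Q.lt x' y' ∧ Q.Insep r x' y' := by
  obtain ⟨y', hy', hxy', -, hmin⟩ := hLF.exists_minimal (S := Q.hypRel r y) (hr.hypRel_refl y) hxy
  obtain ⟨x', hx', hxy'', hxx', hmax⟩ :=
    hLF.exists_maximal (S := Q.hypRel r x) (hr.hypRel_refl x) hxy'
  refine ⟨x', y', hx', hy', hxy'', insep_of_lt hxy'' (fun z hz h1 h2 => ?_) (fun z hz h1 h2 => ?_)
    hr⟩
  · exact hmax z (hr.hypRel_trans hx' hz) h2 h1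
  · exact hmin z (hr.hypRel_trans hy' hz) (lt_of_le_of_lt hxx' h1) h2

/-- Classes with disjoint members have inseparable members. -/
theorem exists_rel_insep (hr : Q.IsAdmissible r) (hLF : Q.LocallyFinite) {h k : P}
    (hd : Q.disjointHyp h k) : ∃ h' k', r h h' ∧ r k k' ∧ Q.Insep r h' k' := by
  obtain ⟨x, hx, y, hy, hxy⟩ := disjointHyp_iff_lt.1 hd
  obtain ⟨x', y', hx', hy', -, hi⟩ := hr.exists_insep hLF hxy
  obtain ⟨h', hh', hhh⟩ := (hr.hypRel_trans (hr.hypRel_of_mem_orient hx) hx').exists_mem_orient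
  obtain ⟨k', hk', hkk⟩ := (hr.hypRel_trans (hr.hypRel_of_mem_orient hy) hy').exists_mem_orient
  exact ⟨h', k', hhh, hkk, hr.insep_congr hh' hk' hi⟩

theorem quotLT_asymm (hr : Q.IsAdmissible r) (hLF : Q.LocallyFinite) {h k : P}
    (hlt : Q.QuotLT r h k) : ¬ Q.QuotLT r k h := by
  intro hlt'
  obtain ⟨h', k', hh, hk, hi⟩ := hr.exists_rel_insep hLF (hr.disjointHyp_of_quotLT hlt)
  exact lt_asymm (hr.lt_of_quotLT (hr.quotLT_congr hlt hh hk) hi)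
    (hr.lt_of_quotLT (hr.quotLT_congr hlt' hk hh) (insep_symm hi))

theorem above_of_quotLT (hr : Q.IsAdmissible r) (hLF : Q.LocallyFinite) {h k : P}
    (hlt : Q.QuotLT r h k) (hi : ∀ m, Q.hypRel r k m → ¬ Q.separates m h k) :
    Q.above (Q.star k) h := by
  refine (disjointHyp_iff.1 (disjointHyp_comm (hr.disjointHyp_of_quotLT hlt))).resolve_left ?_
  intro hab
  obtain ⟨x, hx, hkx⟩ : ∃ x ∈ Q.orient h, Q.lt k x := by
    rcases hab with hab | hab
    exacts [⟨h, Or.inl rfl, hab⟩, ⟨_, Or.inr rfl, hab⟩]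
  obtain ⟨c, hc, hkc, hcx, hmin⟩ := hLF.exists_minimal (S := Q.hypRel r h)
    (hr.hypRel_of_mem_orient hx) hkx
  have hins : Q.Insep r k c := by
    refine insep_of_lt hkc (fun z hz h1 h2 => hi z hz ?_)
      (fun z hz h1 h2 => hmin z (hr.hypRel_trans hc hz) h1 h2) hr
    have hs := separates_comm (separates_of_lt h1 (lt_of_lt_of_le h2 hcx))
    rwa [separates_congr (mem_orient_self z) hx (mem_orient_self k)] at hs
  obtain ⟨h', hh', hhh⟩ := hc.exists_mem_orient
  have h1 := hr.lt_of_quotLT (hr.quotLT_congr hlt hhh (hr.equiv.refl k))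
    (hr.insep_congr hh' (mem_orient_self k) (insep_symm hins))
  rcases hh' with rfl | rfl
  · exact lt_asymm hkc h1
  · exact not_star_lt _ (lt_trans h1 hkc)

theorem exists_separates_of_quotLT (hr : Q.IsAdmissible r) (hLF : Q.LocallyFinite) {h k l : P}
    (hhk : Q.QuotLT r h k) (hkl : Q.QuotLT r k l) : ∃ m, Q.hypRel r k m ∧ Q.separates m h l := by
  obtain ⟨x, hx, y, hy, hxy⟩ := disjointHyp_iff_lt.1 (hr.disjointHyp_of_quotLT hhk)
  obtain ⟨c, hc, hxc, hcy, hmin⟩ := hLF.exists_minimal (S := Q.hypRel r k)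
    (hr.hypRel_of_mem_orient hy) hxy
  obtain ⟨k', hk', hkk⟩ := hc.exists_mem_orient
  have hik : ∀ m, Q.hypRel r k m → ¬ Q.separates m h k' := by
    intro m hm hs
    rw [← separates_congr (mem_orient_self m) hx (mem_orient_comm hk')] at hs
    obtain ⟨m', hm', h1, h2⟩ := exists_lt_lt_of_separates hxc hs
    exact hmin m' (hr.hypRel_trans hm (hr.hypRel_of_mem_orient hm')) h1 h2
  have hhk' := hr.quotLT_congr hhk (hr.equiv.refl h) hkk
  have hkl' := hr.quotLT_congr hkl hkk (hr.equiv.refl l)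
  by_cases hil : ∀ m, Q.hypRel r k m → ¬ Q.separates m k' l
  · have h1 := hr.above_of_quotLT hLF hhk' fun m hm =>
      hik m (hr.hypRel_trans (Or.inl hkk) hm)
    have h2 := hr.above_of_quotLT hLF (hr.quotLT_star_star hkl') (fun m hm hs => hil m
      (hr.hypRel_trans (Or.inr (by simpa [Q.star_star] using hkk)) hm) ?_)
    · rw [Q.star_star, above_star_right] at h2
      exact ⟨k', Or.inl hkk, separates_iff.2 (Or.inr ⟨h1, h2⟩)⟩
    · rw [separates_congr (mem_orient_self m) (star_mem_orient (mem_orient_self l))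
        (star_mem_orient (mem_orient_self k'))] at hs
      exact separates_comm hs
  · push Not at hil
    obtain ⟨m, hm, hs⟩ := hil
    refine ⟨m, hm, ?_⟩
    have hd : Q.disjointHyp m h := by
      obtain ⟨m', hm', hkm⟩ := hm.exists_mem_orient
      exact (disjointHyp_congr hm' (mem_orient_self h)).1
        (disjointHyp_comm (hhk.2.1 h m' (hr.equiv.refl h) hkm))
    have := hik m hm
    rw [separates_iff] at *
    rw [disjointHyp_iff] at hd
    tauto

/-- In the quotient, everything between two classes is represented between any inseparable
representatives of them. -/
theorem exists_between_of_quotLT (hr : Q.IsAdmissible r) (hLF : Q.LocallyFinite) {h k l : P}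
    (hhk : Q.QuotLT r h k) (hkl : Q.QuotLT r k l) (hi : Q.Insep r h l) :
    ∃ m, r k m ∧ Q.lt h m ∧ Q.lt m l := by
  obtain ⟨m, hm, x, hx, m', hm', y, hy, hxm, hmy⟩ := hr.exists_separates_of_quotLT hLF hhk hkl
  have hkm' := hr.hypRel_trans hm (hr.hypRel_of_mem_orient hm')
  have hxyh : ∀ z, Q.hypRel r h z → Q.lt x z → ¬ Q.lt z y := fun z hz h1 h2 =>
    hi z (Or.inl hz) ⟨x, hx, z, mem_orient_self z, y, hy, h1, h2⟩
  have hxyl : ∀ z, Q.hypRel r l z → Q.lt x z → ¬ Q.lt z y := fun z hz h1 h2 =>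
    hi z (Or.inr hz) ⟨x, hx, z, mem_orient_self z, y, hy, h1, h2⟩
  have hxh := hr.hypRel_of_mem_orient hx
  have hyl := hr.hypRel_of_mem_orient hy
  obtain ⟨c, hc, hxc, hcm, hmin⟩ := hLF.exists_minimal (S := Q.hypRel r k) hkm' hxm
  have hxc' : Q.Insep r x c := insep_of_lt hxc
    (fun z hz h1 h2 => hxyh z (hr.hypRel_trans hxh hz) h1 (lt_trans (lt_of_lt_of_le h2 hcm) hmy))
    (fun z hz h1 h2 => hmin z (hr.hypRel_trans hc hz) h1 h2) hr
  obtain ⟨d, hd, hdy, hmd, hmax⟩ := hLF.exists_maximal (S := Q.hypRel r k) hkm' hmy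
  have hdy' : Q.Insep r d y := insep_of_lt hdy
    (fun z hz h1 h2 => hmax z (hr.hypRel_trans hd hz) h2 h1)
    (fun z hz h1 h2 => hxyl z (hr.hypRel_trans hyl hz) (lt_trans (lt_of_lt_of_le hxm hmd) h1) h2) hr
  obtain ⟨c', hc', hkc⟩ := hc.exists_mem_orient
  obtain ⟨d', hd', hkd⟩ := hd.exists_mem_orient
  have h1 := hr.lt_of_quotLT (hr.quotLT_congr hhk (hr.equiv.refl h) hkc)
    (hr.insep_congr (mem_orient_comm hx) hc' hxc')
  have h2 := hr.lt_of_quotLT (hr.quotLT_congr hkl hkd (hr.equiv.refl l))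
    (hr.insep_congr hd' (mem_orient_comm hy) hdy')
  obtain ⟨rfl, rfl⟩ := orient_eq_of_lt hxc h1 (mem_orient_comm hx) hc'
  obtain ⟨rfl, rfl⟩ := orient_eq_of_lt hdy h2 hd' (mem_orient_comm hy)
  exact ⟨_, hkc, h1, lt_of_le_of_lt hcm hmy⟩

theorem quotLT_trans (hr : Q.IsAdmissible r) (hLF : Q.LocallyFinite) {h k l : P}
    (hhk : Q.QuotLT r h k) (hkl : Q.QuotLT r k l) : Q.QuotLT r h l := by
  refine hr.quotLT_of_forall (fun e => ?_) (fun a b ha hb => ?_) (fun a b ha hb hi => ?_)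
  · exact hr.quotLT_asymm hLF hhk (hr.quotLT_congr hkl (hr.equiv.refl k) (hr.equiv.symm e))
  · obtain ⟨m, -, hs⟩ := hr.exists_separates_of_quotLT hLF
      (hr.quotLT_congr hhk ha (hr.equiv.refl k)) (hr.quotLT_congr hkl (hr.equiv.refl k) hb)
    exact disjointHyp_of_separates hs
  · obtain ⟨m, -, h1, h2⟩ := hr.exists_between_of_quotLT hLF
      (hr.quotLT_congr hhk ha (hr.equiv.refl k)) (hr.quotLT_congr hkl (hr.equiv.refl k) hb) hi
    exact lt_trans h1 h2

theorem quotLE_congr (hr : Q.IsAdmissible r) {h k h' k' : P} (hh : r h h') (hk : r k k') :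
    Q.QuotLE r h k ↔ Q.QuotLE r h' k' := by
  have key : ∀ {h k h' k' : P}, r h h' → r k k' → Q.QuotLE r h k → Q.QuotLE r h' k' := by
    rintro h k h' k' hh hk (e | e)
    · exact Or.inl (hr.equiv.trans (hr.equiv.symm hh) (hr.equiv.trans e hk))
    · exact Or.inr (hr.quotLT_congr e hh hk)
  exact ⟨key hh hk, key (hr.equiv.symm hh) (hr.equiv.symm hk)⟩

theorem mk_eq_mk (hr : Q.IsAdmissible r) {a b : P} : Quot.mk r a = Quot.mk r b ↔ r a b := by
  rw [Quot.eq, hr.equiv.eqvGen_iff]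

theorem not_quotLE_star (hr : Q.IsAdmissible r) (a : P) : ¬ Q.QuotLE r a (Q.star a) := by
  rintro (e | e)
  exacts [hr.aer1 a e, (hr.disjointHyp_of_quotLT e).1 (Or.inr rfl)]

/-- The quotient pocset of an admissible equivalence relation. -/
def quot (hr : Q.IsAdmissible r) (hLF : Q.LocallyFinite) : Pocset (Quot r) where
  le := Quot.lift (fun a => Quot.lift (fun b => Q.QuotLE r a b)
      fun _ _ e => propext (hr.quotLE_congr (hr.equiv.refl a) e))
    fun a b e => funext fun c => Quot.inductionOn c fun c =>
      propext (hr.quotLE_congr e (hr.equiv.refl c))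
  star := Quot.map Q.star hr.aer2
  le_refl := by
    rintro ⟨a⟩
    exact Or.inl (hr.equiv.refl a)
  le_trans := by
    rintro ⟨a⟩ ⟨b⟩ ⟨c⟩ (h | h) h'
    · exact (hr.quotLE_congr h (hr.equiv.refl c)).2 h'
    · rcases h' with h' | h'
      · exact Or.inr (hr.quotLT_congr h (hr.equiv.refl a) h')
      · exact Or.inr (hr.quotLT_trans hLF h h')
  le_antisymm := by
    rintro ⟨a⟩ ⟨b⟩ (h | h) (h' | h')
    · exact Quot.sound h
    · exact Quot.sound h
    · exact (Quot.sound h').symm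
    · exact absurd h' (hr.quotLT_asymm hLF h)
  star_star := by
    rintro ⟨a⟩
    exact congrArg (Quot.mk r) (Q.star_star a)
  star_antitone := by
    rintro ⟨a⟩ ⟨b⟩ (h | h)
    · exact Or.inl (hr.equiv.symm (hr.aer2 _ _ h))
    · exact Or.inr (hr.quotLT_star_star h)
  ne_star := by
    rintro ⟨a⟩ h
    exact hr.aer1 a (hr.mk_eq_mk.1 h)
  not_le_star := by
    rintro ⟨a⟩
    exact hr.not_quotLE_star a
  not_star_le := by
    rintro ⟨a⟩ h
    refine hr.not_quotLE_star (Q.star a) ?_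
    rw [Q.star_star]
    exact h

end IsAdmissible

/-! ### The quotient pocset on representatives -/

section Quot

variable (hr : Q.IsAdmissible r) (hLF : Q.LocallyFinite) {a b c : P}

theorem IsAdmissible.quot_le : (hr.quot hLF).le (Quot.mk r a) (Quot.mk r b) ↔ Q.QuotLE r a b :=
  Iff.rfl

theorem IsAdmissible.quot_star : (hr.quot hLF).star (Quot.mk r a) = Quot.mk r (Q.star a) := rfl

theorem IsAdmissible.quot_lt : (hr.quot hLF).lt (Quot.mk r a) (Quot.mk r b) ↔ Q.QuotLT r a b := by
  simp only [lt, hr.quot_le, ne_eq, hr.mk_eq_mk, QuotLE]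
  constructor
  · rintro ⟨h | h, hne⟩
    exacts [absurd h hne, h]
  · exact fun h => ⟨Or.inr h, h.1⟩

theorem IsAdmissible.quot_sameHyp :
    (hr.quot hLF).sameHyp (Quot.mk r a) (Quot.mk r b) ↔ Q.hypRel r a b := by
  simp only [sameHyp, hr.quot_star, hr.mk_eq_mk]
  exact ⟨fun h => hr.hypRel_symm h, fun h => hr.hypRel_symm h⟩

theorem IsAdmissible.quot_transverse :
    (hr.quot hLF).transverse (Quot.mk r a) (Quot.mk r b) ↔ Q.QuotTransverse r a b := by
  simp only [transverse, hr.quot_sameHyp, QuotTransverse, mem_orient, forall_eq_or_imp, forall_eq,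
    hr.quot_star, hr.quot_le]

theorem IsAdmissible.quot_separates :
    (hr.quot hLF).separates (Quot.mk r a) (Quot.mk r b) (Quot.mk r c) ↔
      Q.QuotSeparates r a b c := by
  simp only [separates, QuotSeparates, mem_orient, exists_eq_or_imp, exists_eq_left,
    hr.quot_star, hr.quot_lt]

theorem IsAdmissible.quot_facing :
    (hr.quot hLF).facing (Quot.mk r a) (Quot.mk r b) ↔ Q.QuotFacing r a b :=
  hr.quot_lt hLF

end Quot

namespace IsAdmissible

variable {h k h' k' : P}

/-- Distinct non-transverse classes are nested. -/
theorem exists_quotLT (hr : Q.IsAdmissible r) (hLF : Q.LocallyFinite) (hne : ¬ Q.hypRel r h k)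
    (ht : ¬ Q.QuotTransverse r h k) :
    ∃ x ∈ Q.orient h, ∃ y ∈ Q.orient k, Q.QuotLT r x y := by
  have hd : (hr.quot hLF).disjointHyp (Quot.mk r h) (Quot.mk r k) := by
    rw [disjointHyp, hr.quot_sameHyp, hr.quot_transverse]
    exact ⟨hne, ht⟩
  simpa only [disjointHyp_iff_lt, mem_orient, exists_eq_or_imp, exists_eq_left,
    hr.quot_star, hr.quot_lt] using hd

theorem not_quotTransverse_of_quotLT (hr : Q.IsAdmissible r) (hLF : Q.LocallyFinite)
    (hlt : Q.QuotLT r h k) : ¬ Q.hypRel r h k ∧ ¬ Q.QuotTransverse r h k := by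
  have hd : (hr.quot hLF).disjointHyp (Quot.mk r h) (Quot.mk r k) :=
    disjointHyp_iff_lt.2 ⟨_, mem_orient_self _, _, mem_orient_self _, (hr.quot_lt hLF).2 hlt⟩
  rwa [disjointHyp, hr.quot_sameHyp, hr.quot_transverse] at hd

theorem quotTransverse_congr (hr : Q.IsAdmissible r)
    (hh : Q.hypRel r h h') (hk : Q.hypRel r k k') (ht : Q.QuotTransverse r h k) :
    Q.QuotTransverse r h' k' := by
  refine ⟨fun e => ht.1 (hr.hypRel_trans hh (hr.hypRel_trans e (hr.hypRel_symm hk))), ?_⟩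
  intro a ha b hb
  obtain ⟨a', ha', haa⟩ := (hr.hypRel_trans (hr.hypRel_symm (hr.hypRel_of_mem_orient ha))
    (hr.hypRel_symm hh)).exists_mem_orient
  obtain ⟨b', hb', hbb⟩ := (hr.hypRel_trans (hr.hypRel_symm (hr.hypRel_of_mem_orient hb))
    (hr.hypRel_symm hk)).exists_mem_orient
  rw [hr.quotLE_congr haa hbb, hr.quotLE_congr hbb haa]
  exact ht.2 a' ha' b' hb'

theorem quotTransverse_symm (hr : Q.IsAdmissible r) (ht : Q.QuotTransverse r h k) :
    Q.QuotTransverse r k h :=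
  ⟨fun e => ht.1 (hr.hypRel_symm e), fun a ha b hb => (ht.2 b hb a ha).symm⟩

/-- Transverse halfspaces have transverse classes. -/
theorem quotTransverse_of_transverse (hr : Q.IsAdmissible r) (hLF : Q.LocallyFinite)
    (ht : Q.transverse h k) : Q.QuotTransverse r h k := by
  have hne : ¬ Q.hypRel r h k := by
    rintro (e | e)
    · exact hr.aer3 _ _ ht e
    · refine hr.aer3 h (Q.star k) ⟨fun e' => ht.1 ?_, fun a ha b hb => ht.2 a ha b ?_⟩ e
      · rcases e' with e' | e'
        · right; rw [← e', Q.star_star]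
        · left; rw [← Q.star_star k, e', Q.star_star]
      · rwa [orient_congr (star_mem_orient (mem_orient_self k))] at hb
  by_contra hc
  obtain ⟨x, hx, y, hy, hxy⟩ := hr.exists_quotLT hLF hne hc
  have := hr.disjointHyp_of_quotLT hxy
  rw [disjointHyp_congr hx hy] at this
  exact this.2 ht

end IsAdmissible

/-! ### Relations generated by elementary foldable pairs -/

/-- `r` is the `star`-invariant equivalence relation generated by a set `E` of elementary foldable
pairs for the equivalence relation `s`. -/
structure IsFoldOf (Q : Pocset P) (s E r : P → P → Prop) : Prop where
  equiv : Equivalence r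
  sinv : ∀ a b, r a b → r (Q.star a) (Q.star b)
  base : ∀ x y, E x y → r x y
  facing : ∀ x y, E x y → Q.lt (Q.star x) y
  rel : ∀ x y, E x y → s x y
  insep : ∀ x y, E x y → ∀ m, Q.hypRel s x m → ¬ Q.separates m x y
  elem : ∀ x y, E x y → ∀ m m', Q.hypRel s m m' → Q.separates m x y → Q.separates m' x y →
    Q.sameHyp m m'
  ind : ∀ t : P → P → Prop, Equivalence t →
    (∀ x y, E x y → t x y ∧ t (Q.star x) (Q.star y)) → ∀ a b, r a b → t a b

namespace IsFoldOf

variable {s E : P → P → Prop} {a b h k m x y : P}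

theorem le (hF : Q.IsFoldOf s E r) (hs : Q.IsAdmissible s) (e : r a b) : s a b :=
  hF.ind s hs.equiv (fun x y hE => ⟨hF.rel x y hE, hs.aer2 _ _ (hF.rel x y hE)⟩) a b e

theorem hypRel_le (hF : Q.IsFoldOf s E r) (hs : Q.IsAdmissible s) (e : Q.hypRel r a b) :
    Q.hypRel s a b :=
  e.imp (hF.le hs) (hF.le hs)

theorem hypRel_of_rel (hF : Q.IsFoldOf s E r) (e : Q.hypRel r h a) (e' : r a b) :
    Q.hypRel r h b :=
  e.imp (fun e => hF.equiv.trans e e') fun e => hF.equiv.trans e (hF.sinv _ _ e')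

theorem not_separates (hF : Q.IsFoldOf s E r) (hd : ∀ h', Q.hypRel r h h' → Q.disjointHyp m h')
    (hE : ∀ x y, E x y → Q.hypRel r h x → ¬ Q.separates m x y)
    (ha : Q.hypRel r h a) (hb : Q.hypRel r a b) : ¬ Q.separates m a b := by
  have key : ∀ x y, r x y → r x y ∧ (Q.hypRel r h x → (Q.above m x ↔ Q.above m y)) := by
    intro x y hxy
    refine hF.ind (fun a b => r a b ∧ (Q.hypRel r h a → (Q.above m a ↔ Q.above m b)))
      ⟨fun a => ⟨hF.equiv.refl a, fun _ => Iff.rfl⟩, fun e => ⟨hF.equiv.symm e.1, fun ha =>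
        (e.2 (hF.hypRel_of_rel ha (hF.equiv.symm e.1))).symm⟩, fun e e' =>
        ⟨hF.equiv.trans e.1 e'.1, fun ha => (e.2 ha).trans (e'.2 (hF.hypRel_of_rel ha e.1))⟩⟩
      (fun x y hE' => ?_) x y hxy
    have hb := hF.base x y hE'
    have main : Q.hypRel r h x → (Q.above m x ↔ Q.above m y) := by
      intro hx
      have h1 := disjointHyp_iff.1 (hd x hx)
      have h2 := disjointHyp_iff.1 (hd y (hF.hypRel_of_rel hx hb))
      have h3 := hE x y hE' hx
      rw [separates_iff] at h3
      have h4 := @not_above_star _ Q m x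
      have h5 := @not_above_star _ Q m y
      grind
    refine ⟨⟨hb, main⟩, hF.sinv _ _ hb, fun hx => ?_⟩
    simp only [above_star_right]
    refine main ?_
    rcases hx with hx | hx
    · exact Or.inr hx
    · rw [Q.star_star] at hx
      exact Or.inl hx
  have hab : Q.above m a ↔ Q.above m b := by
    rcases hb with hb | hb
    · exact (key a b hb).2 ha
    · exact ((key _ _ hb).2 ha).trans above_star_right
  rw [separates_iff]
  have h4 := @not_above_star _ Q m a
  have h5 := @not_above_star _ Q m b
  tauto

/-- A hyperplane separating an elementary foldable pair is transverse to it in the quotient. -/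
theorem quotTransverse_of_separates (hF : Q.IsFoldOf s E r) (hs : Q.IsAdmissible s)
    (hLF : Q.LocallyFinite) (hE : E x y) (hm : Q.separates m x y) : Q.QuotTransverse s x m := by
  have hxy := hF.facing x y hE
  have hx := star_mem_orient (Q := Q) (mem_orient_self x)
  obtain ⟨m', hm', h1, h2⟩ := exists_lt_lt_of_separates hxy
    ((separates_congr (mem_orient_self m) hx (mem_orient_self y)).2 hm)
  have hsep : ∀ n, Q.lt (Q.star x) n → Q.lt n y → Q.separates n x y := fun n h3 h4 =>
    (separates_congr (mem_orient_self n) hx (mem_orient_self y)).1 (separates_of_lt h3 h4)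
  have hsx : ∀ n, Q.hypRel s (Q.star x) n → Q.hypRel s x n := fun n hn =>
    hs.hypRel_trans (hs.hypRel_of_mem_orient hx) hn
  have hsy : ∀ n, Q.hypRel s y n → Q.hypRel s x n := fun n hn =>
    hs.hypRel_trans (Or.inl (hF.rel x y hE)) hn
  have hel : ∀ n, Q.hypRel s m' n → Q.lt (Q.star x) n → Q.lt n y → Q.sameHyp m' n :=
    fun n hn h3 h4 => hF.elem x y hE m' n hn (hsep m' h1 h2) (hsep n h3 h4)
  have hi1 : Q.Insep s (Q.star x) m' := insep_of_lt h1
    (fun n hn h3 h4 => hF.insep x y hE n (hsx n hn) (hsep n h3 (lt_trans h4 h2)))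
    (fun n hn h3 h4 => by
      rcases hel n hn h3 (lt_trans h4 h2) with rfl | rfl
      · exact lt_irrefl _ h4
      · exact not_star_lt _ h4) hs
  have hi2 : Q.Insep s m' y := insep_of_lt h2
    (fun n hn h3 h4 => by
      rcases hel n hn (lt_trans h1 h3) h4 with rfl | rfl
      · exact lt_irrefl _ h3
      · exact not_lt_star _ h3)
    (fun n hn h3 h4 => hF.insep x y hE n (hsy n hn) (hsep n (lt_trans h1 h3) h4)) hs
  by_contra hc
  have hne : ¬ Q.hypRel s x m := fun e => hF.insep x y hE m e hm
  obtain ⟨p, hp, q, hq, hpq⟩ := hs.exists_quotLT hLF hne hc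
  rw [orient_congr (mem_orient_comm hx)] at hp
  rw [orient_congr (mem_orient_comm hm')] at hq
  obtain ⟨rfl, rfl⟩ := orient_eq_of_lt h1 (hs.lt_of_quotLT hpq (hs.insep_congr hp hq hi1)) hp hq
  have h3 := hs.lt_of_quotLT (hs.quotLT_congr hpq (hs.aer2 _ _ (hF.rel x y hE))
    (hs.equiv.refl _)) (hs.insep_congr (star_mem_orient (mem_orient_self y)) (mem_orient_self _)
      (insep_symm hi2))
  exact not_star_lt _ (lt_trans h3 h2)

/-- A class of `r` contains every hyperplane separating two of its members that is not transverse
to it. -/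
theorem hypRel_of_separates (hF : Q.IsFoldOf s E r) (hs : Q.IsAdmissible s)
    (hLF : Q.LocallyFinite) (hxy : Q.hypRel r x y) (hm : Q.separates m x y)
    (ht : ¬ Q.QuotTransverse s x m) : Q.hypRel r x m := by
  by_contra hc
  have hx : Q.hypRel r x x := Or.inl (hF.equiv.refl x)
  refine hF.not_separates (h := x) (fun z hz => ⟨fun e => hc ?_, fun htr => ht ?_⟩)
    (fun u v hE hu hsep => ht ?_) hx hxy hm
  · rcases e with rfl | rfl
    · exact hz
    · exact hz.symm.imp (fun e => by rwa [Q.star_star] at e) id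
  · have := hs.quotTransverse_of_transverse hLF htr
    exact hs.quotTransverse_symm (hs.quotTransverse_congr (hs.hypRel_refl m)
      (hs.hypRel_symm (hF.hypRel_le hs hz)) this)
  · exact hs.quotTransverse_congr (hs.hypRel_symm (hF.hypRel_le hs hu)) (hs.hypRel_refl m)
      (hF.quotTransverse_of_separates hs hLF hE hsep)

theorem isAdmissible (hF : Q.IsFoldOf s E r) (hs : Q.IsAdmissible s)
    (hLF : Q.LocallyFinite) : Q.IsAdmissible r where
  equiv := hF.equiv
  aer1 h e := hs.aer1 h (hF.le hs e)
  aer2 := hF.sinv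
  aer3 h k ht e := hs.aer3 h k ht (hF.le hs e)
  aer4 h k e hne hi a ha b hb hab := by
    have hsab : s a b := by
      refine hs.aer4 h k (hF.hypRel_le hs e) hne (fun m hm hsep => ?_) a ha b hb hab
      exact hi m (hF.hypRel_of_separates hs hLF e hsep fun ht => ht.1 hm) hsep
    have hrab : Q.hypRel r a b := by
      have h1 : Q.hypRel r a k := by
        rcases ha with rfl | rfl
        · exact e
        · rcases e with e | e
          · exact Or.inr (hF.sinv _ _ e)
          · exact Or.inl (by simpa [Q.star_star] using hF.sinv _ _ e)
      rcases hb with rfl | rfl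
      · exact h1
      · exact h1.symm.imp id fun e => by rwa [Q.star_star]
    rcases hrab with e | e
    · exact e
    · exact absurd (hs.equiv.trans (hs.equiv.symm hsab) (hF.le hs e)) (hs.aer1 b)

end IsFoldOf

/-! ### Nested classes -/

namespace IsAdmissible

variable {a b h k : P}

theorem above_of_insep (hr : Q.IsAdmissible r)
    (hd : ∀ x y, Q.hypRel r a x → Q.hypRel r b y → Q.disjointHyp x y)
    (hb : ∀ m x y, Q.hypRel r a m → Q.hypRel r b x → Q.hypRel r b y → ¬ Q.separates m x y)
    (hab : Q.lt a b) (hi : Q.Insep r a b) (hh : r a h) (hk : r b k) (hi' : Q.Insep r h k) :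
    Q.above h k := by
  have side : ∀ m, Q.hypRel r a m → (Q.above m b ↔ Q.above m k) := by
    intro m hm
    have h1 := disjointHyp_iff.1 (hd m b hm (hr.hypRel_refl b))
    have h2 := disjointHyp_iff.1 (hd m k hm (Or.inl hk))
    have h3 := hb m b k hm (hr.hypRel_refl b) (Or.inl hk)
    rw [separates_iff] at h3
    have h4 := @not_above_star _ Q m b
    have h5 := @not_above_star _ Q m k
    grind
  have hak : Q.above a k := (side a (hr.hypRel_refl a)).1 (Or.inl hab)
  by_cases e : a = h
  · rwa [← e]
  have hdh := hr.disjointHyp_of_rel hh e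
  have hin : ∀ m, Q.hypRel r a m → ¬ Q.separates m a h := by
    intro m hm hs
    have h1 := hi m (Or.inl hm)
    have h2 := hi' m (Or.inl (hr.hypRel_trans (hr.hypRel_symm (Or.inl hh)) hm))
    have h3 := side m hm
    have h4 := disjointHyp_iff.1 (hd m b hm (hr.hypRel_refl b))
    have h5 := disjointHyp_iff.1 (hd m k hm (Or.inl hk))
    have h6 := @not_above_star _ Q m b
    have h7 := @not_above_star _ Q m k
    rw [separates_iff] at h1 h2 hs
    grind
  have h4 := hr.aer4 a h (Or.inl hh) hdh.1 hin
  have hsa := star_mem_orient (Q := Q) (mem_orient_self a)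
  have hsh := star_mem_orient (Q := Q) (mem_orient_self h)
  have hcase : Q.lt (Q.star a) h ∨ Q.lt a (Q.star h) := by
    obtain ⟨x, hx, y, hy, hxy⟩ := disjointHyp_iff_lt.1 hdh
    rcases hx with rfl | rfl <;> rcases hy with rfl | rfl
    · have := h4 _ hsa _ (mem_orient_self y) (by rwa [facing, Q.star_star])
      exact absurd (hr.equiv.trans hh (hr.equiv.symm this)) (hr.aer1 _)
    · exact Or.inr hxy
    · exact Or.inl hxy
    · have := h4 _ (mem_orient_self a) _ hsh hxy
      exact absurd (hr.equiv.trans (hr.equiv.symm hh) this) (hr.aer1 _)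
  rcases hcase with h5 | h5
  · exact absurd (separates_iff.2 (Or.inr ⟨Or.inl h5, hak⟩))
      (hi' a (Or.inl (Or.inl (hr.equiv.symm hh))))
  · rw [← side h (Or.inl hh)]
    refine (disjointHyp_iff.1 (hd h b (Or.inl hh) (hr.hypRel_refl b))).resolve_right fun h6 => ?_
    exact hi h (Or.inl (Or.inl hh)) (separates_iff.2 (Or.inl ⟨Or.inr (lt_star_comm h5), h6⟩))

theorem quotLT_of_nested (hr : Q.IsAdmissible r)
    (hd : ∀ x y, Q.hypRel r a x → Q.hypRel r b y → Q.disjointHyp x y)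
    (ha : ∀ m x y, Q.hypRel r b m → Q.hypRel r a x → Q.hypRel r a y → ¬ Q.separates m x y)
    (hb : ∀ m x y, Q.hypRel r a m → Q.hypRel r b x → Q.hypRel r b y → ¬ Q.separates m x y)
    (hab : Q.lt a b) (hi : Q.Insep r a b) : Q.QuotLT r a b := by
  refine hr.quotLT_of_forall (fun e => ?_) (fun x y hx hy => hd x y (Or.inl hx) (Or.inl hy))
    (fun x y hx hy hxy => lt_iff_above.2 ⟨hr.above_of_insep hd hb hab hi hx hy hxy, ?_⟩)
  · exact (hd b b (Or.inl e) (hr.hypRel_refl b)).1 (Or.inl rfl)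
  · have hsa : ∀ {a x : P}, Q.hypRel r (Q.star a) x → Q.hypRel r a x := fun h =>
      hr.hypRel_trans (hr.hypRel_of_mem_orient (star_mem_orient (mem_orient_self _))) h
    have so : ∀ x : P, Q.star x ∈ Q.orient x := fun x => star_mem_orient (mem_orient_self x)
    rw [← above_star_right]
    exact hr.above_of_insep (a := Q.star b) (b := Q.star a)
      (fun u v hu hv => disjointHyp_comm (hd v u (hsa hv) (hsa hu)))
      (fun m u v hm hu hv => ha m u v (hsa hm) (hsa hu) (hsa hv)) (lt_star_star hab)
      (hr.insep_congr (so b) (so a) (insep_symm hi)) (hr.aer2 _ _ hy) (hr.aer2 _ _ hx)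
      (hr.insep_congr (so y) (so x) (insep_symm hxy))

end IsAdmissible

namespace IsFoldOf

variable {s E : P → P → Prop} {h k x y : P}

/-- Classes of `r` are transverse only if the classes of `s` containing them are. -/
theorem quotTransverse_le (hF : Q.IsFoldOf s E r) (hs : Q.IsAdmissible s) (hLF : Q.LocallyFinite)
    (ht : Q.QuotTransverse r h k) : Q.QuotTransverse s h k := by
  have hr := hF.isAdmissible hs hLF
  by_contra hc
  have hne : ∀ {u v}, Q.hypRel r h u → Q.hypRel r k v → ¬ Q.hypRel r u v := fun hu hv e =>
    ht.1 (hr.hypRel_trans hu (hr.hypRel_trans e (hr.hypRel_symm hv)))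
  have hnt : ∀ {u v}, Q.hypRel r h u → Q.hypRel r k v → ¬ Q.QuotTransverse s u v :=
    fun hu hv e => hc (hs.quotTransverse_congr (hs.hypRel_symm (hF.hypRel_le hs hu))
      (hs.hypRel_symm (hF.hypRel_le hs hv)) e)
  have hd : ∀ u v, Q.hypRel r h u → Q.hypRel r k v → Q.disjointHyp u v := fun u v hu hv =>
    ⟨fun e => hne hu hv (hr.hypRel_of_mem_orient e),
      fun e => hnt hu hv (hs.quotTransverse_of_transverse hLF e)⟩
  obtain ⟨x, hx, y, hy, hxy⟩ :=
    disjointHyp_iff_lt.1 (hd h k (hr.hypRel_refl h) (hr.hypRel_refl k))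
  obtain ⟨x', y', hx', hy', hxy', hi⟩ := hr.exists_insep hLF hxy
  have hhx : Q.hypRel r h x' := hr.hypRel_trans (hr.hypRel_of_mem_orient hx) hx'
  have hky : Q.hypRel r k y' := hr.hypRel_trans (hr.hypRel_of_mem_orient hy) hy'
  have tx : ∀ {u}, Q.hypRel r x' u → Q.hypRel r h u := hr.hypRel_trans hhx
  have ty : ∀ {u}, Q.hypRel r y' u → Q.hypRel r k u := hr.hypRel_trans hky
  have hlt : Q.QuotLT r x' y' := by
    refine hr.quotLT_of_nested (fun u v hu hv => hd u v (tx hu) (ty hv))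
      (fun m u v hm hu hv hsep => ?_) (fun m u v hm hu hv hsep => ?_) hxy' hi
    · exact hne (tx hu) (ty hm) (hF.hypRel_of_separates hs hLF
        (hr.hypRel_trans (hr.hypRel_symm hu) hv) hsep (hnt (tx hu) (ty hm)))
    · exact hne (tx hm) (ty hu) (hr.hypRel_symm (hF.hypRel_of_separates hs hLF
        (hr.hypRel_trans (hr.hypRel_symm hu) hv) hsep
          fun e => hnt (tx hm) (ty hu) (hs.quotTransverse_symm e)))
  exact (hr.not_quotTransverse_of_quotLT hLF hlt).2 (hr.quotTransverse_congr hhx hky ht)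

theorem quotLT_of_lt (hF : Q.IsFoldOf s E r) (hs : Q.IsAdmissible s) (hLF : Q.LocallyFinite)
    (hne : ¬ Q.hypRel r x y) (ht : ¬ Q.QuotTransverse s x y) (hi : Q.Insep r x y)
    (hxy : Q.lt x y) : Q.QuotLT r x y := by
  have hr := hF.isAdmissible hs hLF
  obtain ⟨p, hp, q, hq, hpq⟩ :=
    hr.exists_quotLT hLF hne fun e => ht (hF.quotTransverse_le hs hLF e)
  obtain ⟨rfl, rfl⟩ := orient_eq_of_lt hxy (hr.lt_of_quotLT hpq (hr.insep_congr hp hq hi)) hp hq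
  exact hpq

end IsFoldOf

/-! ### Chains of classes in a nested family -/

section Chain

variable {s E : P → P → Prop} {S : P → Prop} {x y : P}

/-- The hyperplane of `x` has an orientation in `S`. -/
def hypMem (Q : Pocset P) (S : P → Prop) (x : P) : Prop := S x ∨ S (Q.star x)

theorem hypMem_of_hypRel (hs : Q.IsAdmissible s) (hS : ∀ a b, S a → s a b → S b)
    (hx : Q.hypMem S x) (e : Q.hypRel s x y) : Q.hypMem S y := by
  rcases e with e | e <;> rcases hx with hx | hx
  · exact Or.inl (hS _ _ hx e)
  · exact Or.inr (hS _ _ hx (hs.aer2 _ _ e))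
  · exact Or.inr (hS _ _ hx e)
  · exact Or.inl (hS _ _ hx (hs.rel_star_iff.2 e |> fun e => by simpa [Q.star_star] using e))

/-- If `S` is a union of `s`-classes forming a nested family in which consecutive halfspaces `x < y`
have alternating membership in `S`, then the same alternation holds for consecutive `r`-classes. -/
theorem IsFoldOf.alternating (hF : Q.IsFoldOf s E r) (hs : Q.IsAdmissible s)
    (hLF : Q.LocallyFinite) (hS : ∀ a b, S a → s a b → S b) (hS' : ∀ a, S a → ¬ S (Q.star a))
    (hnest : ∀ a b, Q.hypMem S a → Q.hypMem S b → ¬ Q.QuotTransverse s a b)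
    (hface : ∀ a b, Q.hypMem S a → Q.hypMem S b → Q.lt a b →
      (∀ z, Q.hypMem S z → Q.lt a z → ¬ Q.lt z b) →
      (S a ↔ ¬ S b) ∧ (¬ Q.hypRel s a b → S b))
    (hx : Q.hypMem S x) (hy : Q.hypMem S y) (hxy : Q.lt x y) (hne : ¬ Q.hypRel r x y)
    (hi : Q.Insep r x y)
    (hbt : ∀ z, Q.hypMem S z → Q.lt x z → Q.lt z y → Q.QuotLT r x z → ¬ Q.QuotLT r z y) :
    (S x ↔ ¬ S y) ∧ (¬ Q.hypRel s x y → S y) := by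
  have hr := hF.isAdmissible hs hLF
  induction hn : {c | Q.le x c ∧ Q.le c y}.ncard using Nat.strong_induction_on generalizing x with
  | _ n ih =>
  by_cases h : ∀ z, Q.hypMem S z → Q.lt x z → ¬ Q.lt z y
  · exact hface x y hx hy hxy h
  push Not at h
  obtain ⟨z, hz, hxz, hzy⟩ := h
  have mem : ∀ {u v}, Q.hypMem S u → Q.hypRel r u v → Q.hypMem S v := fun hu e =>
    hypMem_of_hypRel hs hS hu (hF.hypRel_le hs e)
  have hix : ∀ z, Q.hypRel r x z → Q.lt x z → ¬ Q.lt z y := fun z hz h1 h2 =>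
    hi z (Or.inl hz) (separates_of_lt h1 h2)
  have hiy : ∀ z, Q.hypRel r y z → Q.lt x z → ¬ Q.lt z y := fun z hz h1 h2 =>
    hi z (Or.inr hz) (separates_of_lt h1 h2)
  obtain ⟨e, he, hxe, hez, hemin⟩ := hLF.exists_minimal (S := Q.hypMem S) hz hxz
  have hey := lt_of_le_of_lt hez hzy
  obtain ⟨e', hee, hey', hle, hmax⟩ :=
    hLF.exists_maximal (S := Q.hypRel r e) (hr.hypRel_refl e) hey
  have hxe' := lt_of_lt_of_le hxe hle
  have he' := mem he hee
  have hxe_r : Q.QuotLT r x e := hF.quotLT_of_lt hs hLF (fun h => hix e h hxe hey)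
    (hnest _ _ hx he) (insep_of_lt hxe (fun z hz h1 h2 => hix z hz h1 (lt_trans h2 hey))
      (fun z hz h1 h2 => hemin z (mem he hz) h1 h2) hr) hxe
  have hne' : ¬ Q.hypRel r e' y := fun h => hiy e' (hr.hypRel_symm h) hxe' hey'
  have hie' : ∀ z, Q.hypRel r e' z → Q.lt e' z → ¬ Q.lt z y := fun z hz h1 h2 =>
    hmax z (hr.hypRel_trans hee hz) h2 h1
  have hi' : Q.Insep r e' y := insep_of_lt hey' hie'
    (fun z hz h1 h2 => hiy z hz (lt_trans hxe' h1) h2) hr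
  have hey_r : Q.QuotLT r e' y := hF.quotLT_of_lt hs hLF hne' (hnest _ _ he' hy) hi' hey'
  have hrs : r e' (Q.star e) := by
    rcases hr.hypRel_symm hee with h | h
    · exact absurd hey_r (hbt e' he' hxe' hey'
        (hr.quotLT_congr hxe_r (hr.equiv.refl x) (hr.equiv.symm h)))
    · exact h
  have hlt : {c | Q.le e' c ∧ Q.le c y}.ncard < n := by
    rw [← hn]
    refine Set.ncard_lt_ncard ⟨fun c hc => ⟨Q.le_trans hxe'.1 hc.1, hc.2⟩, fun hsub => ?_⟩
      (hLF x y)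
    exact hxe'.2 (Q.le_antisymm hxe'.1 (hsub ⟨Q.le_refl x, hxy.1⟩).1)
  have IH := ih _ hlt he' hey' hne' hi' (fun z hz hez hzy hez_r hzy_r => by
    have hnez := (hr.not_quotTransverse_of_quotLT hLF hez_r).1
    obtain ⟨c, hc, hec, hcz, hcmin⟩ :=
      hLF.exists_minimal (S := Q.hypRel r z) (hr.hypRel_refl z) hez
    have hcy := lt_of_le_of_lt hcz hzy
    have hiec : Q.Insep r e' c := insep_of_lt hec
      (fun w hw h1 h2 => hie' w hw h1 (lt_trans h2 hcy))
      (fun w hw h1 h2 => hcmin w (hr.hypRel_trans hc hw) h1 h2) hr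
    have hzc : r z c := by
      refine hc.resolve_right fun h => ?_
      have h1 := hr.lt_of_quotLT (hr.quotLT_congr hez_r (hr.equiv.refl _) h)
        (hr.insep_congr (mem_orient_self _) (star_mem_orient (mem_orient_self _)) hiec)
      exact not_lt_star _ (lt_trans hec (lt_star_comm h1))
    have hxc := lt_trans hxe' hec
    have hixc : Q.Insep r x c := by
      refine insep_of_lt hxc (fun w hw h1 h2 => hix w hw h1 (lt_trans h2 hcy))
        (fun w hw h1 h2 => ?_) hr
      have hzw := hr.hypRel_trans hc hw
      have hnew : ¬ Q.hypRel r e' w := fun h =>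
        hnez (hr.hypRel_trans h (hr.hypRel_symm hzw))
      have hwe : Q.disjointHyp w e' := ⟨fun h =>
        hnew (hr.hypRel_symm (hr.hypRel_of_mem_orient h)), fun h =>
        hnest w e' (mem hz hzw) he' (hs.quotTransverse_of_transverse hLF h)⟩
      have hwe' : Q.lt w e' := by
        exact (lt_or_lt_of_disjointHyp hwe h1 hxe' h2 hec).resolve_right fun h =>
          hcmin w hzw h h2
      exact hnew (hr.hypRel_symm (hF.hypRel_of_separates hs hLF (hr.hypRel_symm hw)
        (separates_of_lt hwe' hec) (hnest _ _ (mem hz hzw) he')))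
    have hxc_r := hF.quotLT_of_lt hs hLF (fun h => hix c h hxc hcy)
      (hnest _ _ hx (mem hz hc)) hixc hxc
    exact hbt z hz (lt_trans hxe' hez) hzy
      (hr.quotLT_congr hxc_r (hr.equiv.refl x) (hr.equiv.symm hzc)) hzy_r) rfl
  obtain ⟨hf1, hf2⟩ := hface x e hx he hxe hemin
  have hSe : S e' ↔ ¬ S e := by
    have h1 : S e' ↔ S (Q.star e) :=
      ⟨fun h => hS _ _ h (hF.le hs hrs), fun h => hS _ _ h (hs.equiv.symm (hF.le hs hrs))⟩
    have h2 := hS' e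
    rw [h1]
    exact ⟨fun h h' => h2 h' h, fun h => he.resolve_left h⟩
  refine ⟨by tauto, fun hnxy => ?_⟩
  by_cases hxe_s : Q.hypRel s x e
  · refine IH.2 fun h => hnxy ?_
    exact hs.hypRel_trans hxe_s (hs.hypRel_trans (hF.hypRel_le hs hee) h)
  · have := hf2 hxe_s
    tauto

end Chain

section Face

variable {s E : P → P → Prop} {S : P → Prop} {a b x y : P}

/-- Consecutive halfspaces of the same class alternate. -/
theorem IsAdmissible.alternating_of_hypRel (hs : Q.IsAdmissible s)
    (hS : ∀ a b, S a → s a b → S b) (hS' : ∀ a, S a → ¬ S (Q.star a)) (hb : Q.hypMem S b)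
    (hab : Q.lt a b) (e : Q.hypRel s a b) (hi : ∀ z, Q.hypRel s a z → Q.lt a z → ¬ Q.lt z b) :
    S a ↔ ¬ S b := by
  have h : s (Q.star a) b := by
    refine hs.aer4 a b e ?_ (fun m hm hsep => ?_) _ (star_mem_orient (mem_orient_self a)) _
      (mem_orient_self b) (by rwa [facing, Q.star_star])
    · exact (disjointHyp_iff.2 (Or.inl (Or.inl hab))).1
    · obtain ⟨m', hm', h1, h2⟩ := exists_lt_lt_of_separates hab hsep
      exact hi m' (hs.hypRel_trans hm (hs.hypRel_of_mem_orient hm')) h1 h2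
  constructor
  · exact fun ha hb => hS' a ha (hS _ _ hb (hs.equiv.symm h))
  · exact fun hb' => hS _ _ (hb.resolve_left hb') (hs.equiv.symm (hs.rel_star_iff.1 h))

/-- Consecutive halfspaces of two nested classes are oriented as the classes are. -/
theorem IsAdmissible.rel_of_quotLT (hs : Q.IsAdmissible s) (hlt : Q.QuotLT s a b)
    (hxy : Q.lt x y) (hx : Q.hypRel s a x) (hy : Q.hypRel s b y) (hi : Q.Insep s x y) :
    s a x ∧ s b y := by
  obtain ⟨x', hx', hax⟩ := hx.exists_mem_orient
  obtain ⟨y', hy', hby⟩ := hy.exists_mem_orient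
  obtain ⟨rfl, rfl⟩ := orient_eq_of_lt hxy
    (hs.lt_of_quotLT (hs.quotLT_congr hlt hax hby) (hs.insep_congr hx' hy' hi)) hx' hy'
  exact ⟨hax, hby⟩

/-- Consecutive `r`-classes contained in the same class of `s` are facing up to sign. -/
theorem IsFoldOf.star_rel_of_quotLT (hF : Q.IsFoldOf s E r) (hs : Q.IsAdmissible s)
    (hLF : Q.LocallyFinite) (hxy : Q.QuotLT r x y) (e : Q.hypRel s x y)
    (hbt : ∀ z, Q.hypRel s y z → Q.QuotLT r x z → ¬ Q.QuotLT r z y) : s (Q.star x) y := by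
  have hr := hF.isAdmissible hs hLF
  obtain ⟨x', y', hx, hy, hi⟩ := hr.exists_rel_insep hLF (hr.disjointHyp_of_quotLT hxy)
  have hxy' := hr.quotLT_congr hxy hx hy
  have hS : ∀ a b, s y a → s a b → s y b := fun _ _ => hs.equiv.trans
  have hS' : ∀ a, s y a → ¬ s y (Q.star a) := fun a h h' =>
    hs.aer1 a (hs.equiv.trans (hs.equiv.symm h) h')
  have hFx : Q.hypMem (s y) x' := hs.hypRel_trans (hs.hypRel_symm e) (Or.inl (hF.le hs hx))
  have hFy : Q.hypMem (s y) y' := Or.inl (hF.le hs hy)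
  have hrel : ∀ {u v}, Q.hypMem (s y) u → Q.hypMem (s y) v → Q.hypRel s u v := fun hu hv =>
    hs.hypRel_trans (hs.hypRel_symm hu) hv
  have key := (hF.alternating (S := s y) hs hLF hS hS' (fun u v hu hv ht => ht.1 (hrel hu hv))
    (fun u v hu hv huv hbt => ⟨hs.alternating_of_hypRel hS hS' hv huv (hrel hu hv)
      fun z hz => hbt z (hs.hypRel_trans hu hz), fun h => absurd (hrel hu hv) h⟩)
    hFx hFy (hr.lt_of_quotLT hxy' hi) (hr.not_quotTransverse_of_quotLT hLF hxy').1 hi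
    (fun z hz _ _ h1 h2 => hbt z hz (hr.quotLT_congr h1 (hr.equiv.symm hx) (hr.equiv.refl z))
      (hr.quotLT_congr h2 (hr.equiv.refl z) (hr.equiv.symm hy)))).1
  have h : s y (Q.star x') := hFx.resolve_left fun h => key.1 h (hF.le hs hy)
  exact hs.rel_star_iff.2 (hs.equiv.symm (hs.equiv.trans h (hs.aer2 _ _
    (hs.equiv.symm (hF.le hs hx)))) |> fun h => by
      simpa [Q.star_star] using hs.aer2 _ _ h)

/-- Consecutive `r`-classes in a pair of nested classes of `s` are nested as those are. -/
theorem IsFoldOf.quotLT_of_quotLT (hF : Q.IsFoldOf s E r) (hs : Q.IsAdmissible s)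
    (hLF : Q.LocallyFinite) (hab : Q.QuotLT s a b) (hx : s a x) (hy : s b y)
    (hbt : ∀ z, Q.hypRel s a z ∨ Q.hypRel s b z → ¬ Q.QuotSeparates r z x y) :
    Q.QuotLT r x y := by
  have hr := hF.isAdmissible hs hLF
  obtain ⟨hne, hnt⟩ := hs.not_quotTransverse_of_quotLT hLF hab
  let S : P → Prop := fun z => s (Q.star a) z ∨ s b z
  have hmem : ∀ {z}, Q.hypMem S z ↔ Q.hypRel s a z ∨ Q.hypRel s b z := by
    intro z
    simp only [hypMem, S, hypRel, hs.rel_star_iff (h := a), Q.star_star]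
    tauto
  have hS : ∀ u v, S u → s u v → S v := fun u v h e =>
    h.imp (fun h => hs.equiv.trans h e) (fun h => hs.equiv.trans h e)
  have hS' : ∀ u, S u → ¬ S (Q.star u) := by
    rintro u (h | h) (h' | h')
    · exact hs.aer1 u (hs.equiv.trans (hs.equiv.symm h) h')
    · refine hab.1 (hs.equiv.trans (hs.rel_star_iff.1 h) (hs.equiv.symm h'))
    · refine hab.1 (hs.equiv.trans ?_ (hs.equiv.symm h))
      simpa [Q.star_star] using hs.aer2 _ _ h'
    · exact hs.aer1 u (hs.equiv.trans (hs.equiv.symm h) h')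
  have hcase : ∀ {u v}, Q.hypMem S u → Q.hypMem S v → Q.hypRel s u v ∨
      (Q.hypRel s a u ∧ Q.hypRel s b v) ∨ (Q.hypRel s b u ∧ Q.hypRel s a v) := by
    intro u v hu hv
    rcases hmem.1 hu with hu | hu <;> rcases hmem.1 hv with hv | hv
    · exact Or.inl (hs.hypRel_trans (hs.hypRel_symm hu) hv)
    · exact Or.inr (Or.inl ⟨hu, hv⟩)
    · exact Or.inr (Or.inr ⟨hu, hv⟩)
    · exact Or.inl (hs.hypRel_trans (hs.hypRel_symm hu) hv)
  have hnest : ∀ u v, Q.hypMem S u → Q.hypMem S v → ¬ Q.QuotTransverse s u v := by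
    intro u v hu hv ht
    rcases hcase hu hv with h | ⟨h, h'⟩ | ⟨h, h'⟩
    · exact ht.1 h
    · exact hnt (hs.quotTransverse_congr (hs.hypRel_symm h) (hs.hypRel_symm h') ht)
    · exact hnt (hs.quotTransverse_symm
        (hs.quotTransverse_congr (hs.hypRel_symm h) (hs.hypRel_symm h') ht))
  have hface : ∀ u v, Q.hypMem S u → Q.hypMem S v → Q.lt u v →
      (∀ z, Q.hypMem S z → Q.lt u z → ¬ Q.lt z v) →
      (S u ↔ ¬ S v) ∧ (¬ Q.hypRel s u v → S v) := by
    intro u v hu hv huv hz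
    have hins : Q.Insep s u v := insep_of_lt huv
      (fun z e => hz z (hypMem_of_hypRel hs hS hu e))
      (fun z e => hz z (hypMem_of_hypRel hs hS hv e)) hs
    have hfin : S (Q.star u) ∧ S v → (S u ↔ ¬ S v) ∧ (¬ Q.hypRel s u v → S v) := fun h =>
      ⟨⟨fun h' => absurd h.1 (hS' u h'), fun h' => absurd h.2 h'⟩, fun _ => h.2⟩
    rcases hcase hu hv with h | ⟨h, h'⟩ | ⟨h, h'⟩
    · exact ⟨hs.alternating_of_hypRel hS hS' hv huv h
        fun z e => hz z (hypMem_of_hypRel hs hS hu e), fun h' => absurd h h'⟩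
    · obtain ⟨h1, h2⟩ := hs.rel_of_quotLT hab huv h h' hins
      exact hfin ⟨Or.inl (hs.aer2 _ _ h1), Or.inr h2⟩
    · obtain ⟨h1, h2⟩ := hs.rel_of_quotLT (hs.quotLT_star_star hab) huv
        (hs.hypRel_trans (hs.hypRel_symm (hs.hypRel_of_mem_orient
          (star_mem_orient (mem_orient_self b)))) h)
        (hs.hypRel_trans (hs.hypRel_symm (hs.hypRel_of_mem_orient
          (star_mem_orient (mem_orient_self a)))) h') hins
      exact hfin ⟨Or.inr (hs.rel_star_iff.1 h1), Or.inl h2⟩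
  obtain ⟨x', y', hxx, hyy, hi⟩ := hr.exists_rel_insep hLF (hab.2.1 x y hx hy)
  have hax := hs.equiv.trans hx (hF.le hs hxx)
  have hby := hs.equiv.trans hy (hF.le hs hyy)
  obtain ⟨p, hp, q, hq, hpq⟩ := disjointHyp_iff_lt.1 (hab.2.1 x' y' hax hby)
  have hap := hs.hypRel_trans (Or.inl hax) (hs.hypRel_of_mem_orient hp)
  have hbq := hs.hypRel_trans (Or.inl hby) (hs.hypRel_of_mem_orient hq)
  have hnepq : ¬ Q.hypRel s p q := fun e =>
    hne (hs.hypRel_trans hap (hs.hypRel_trans e (hs.hypRel_symm hbq)))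
  obtain ⟨h1, h2⟩ := hF.alternating hs hLF hS hS' hnest hface (hmem.2 (Or.inl hap))
    (hmem.2 (Or.inr hbq)) hpq (fun e => hnepq (hF.hypRel_le hs e)) (hr.insep_congr hp hq hi)
    (fun z hz _ _ hpz hzq => by
      obtain ⟨p', hp', hpp⟩ := (hr.hypRel_trans (hr.hypRel_symm (hr.hypRel_of_mem_orient hp))
        (Or.inl (hr.equiv.symm hxx))).exists_mem_orient
      obtain ⟨q', hq', hqq⟩ := (hr.hypRel_trans (hr.hypRel_symm (hr.hypRel_of_mem_orient hq))
        (Or.inl (hr.equiv.symm hyy))).exists_mem_orient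
      exact hbt z (hmem.1 hz) ⟨p', hp', z, mem_orient_self z, q', hq',
        hr.quotLT_congr hpz hpp (hr.equiv.refl z), hr.quotLT_congr hzq (hr.equiv.refl z) hqq⟩)
  have hq' : q = y' := hq.resolve_right fun e =>
    hS' y' (Or.inr hby) (e ▸ h2 hnepq)
  have hp' : p = x' := hp.resolve_right fun e =>
    h1.1 (Or.inl (e ▸ hs.aer2 _ _ hax)) (h2 hnepq)
  subst hp' hq'
  exact hr.quotLT_congr (hF.quotLT_of_lt hs hLF (fun e => hnepq (hF.hypRel_le hs e))
    (hnest _ _ (hmem.2 (Or.inl hap)) (hmem.2 (Or.inr hbq))) hi hpq) (hr.equiv.symm hxx)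
    (hr.equiv.symm hyy)

end Face

/-! ### Iterated quotients -/

namespace IsFoldOf

variable {s E : P → P → Prop} {s₁ : Quot r → Quot r → Prop} {a b c : P}

theorem quot_hypRel (hr : Q.IsAdmissible r) (hLF : Q.LocallyFinite)
    (h₁ : ∀ a b, s₁ (Quot.mk r a) (Quot.mk r b) ↔ s a b) :
    (hr.quot hLF).hypRel s₁ (Quot.mk r a) (Quot.mk r b) ↔ Q.hypRel s a b := by
  simp only [hypRel, hr.quot_star, h₁]

theorem quot_isAdmissible (hF : Q.IsFoldOf s E r) (hs : Q.IsAdmissible s)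
    (hLF : Q.LocallyFinite) (h₁ : ∀ a b, s₁ (Quot.mk r a) (Quot.mk r b) ↔ s a b) :
    ((hF.isAdmissible hs hLF).quot hLF).IsAdmissible s₁ := by
  have hr := hF.isAdmissible hs hLF
  refine ⟨⟨?_, ?_, ?_⟩, ?_, ?_, ?_, ?_⟩
  · rintro ⟨a⟩
    exact (h₁ a a).2 (hs.equiv.refl a)
  · rintro ⟨a⟩ ⟨b⟩ h
    exact (h₁ b a).2 (hs.equiv.symm ((h₁ a b).1 h))
  · rintro ⟨a⟩ ⟨b⟩ ⟨c⟩ h h'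
    exact (h₁ a c).2 (hs.equiv.trans ((h₁ a b).1 h) ((h₁ b c).1 h'))
  · rintro ⟨a⟩ h
    exact hs.aer1 a ((h₁ a _).1 h)
  · rintro ⟨a⟩ ⟨b⟩ h
    exact (h₁ _ _).2 (hs.aer2 a b ((h₁ a b).1 h))
  · rintro ⟨a⟩ ⟨b⟩ ht h
    exact (hF.quotTransverse_le hs hLF ((hr.quot_transverse hLF).1 ht)).1 (Or.inl ((h₁ a b).1 h))
  · have key : ∀ a b : P, Q.hypRel s a b →
        (∀ m, Q.hypRel s a m → ¬ Q.QuotSeparates r m a b) → Q.QuotLT r (Q.star a) b → s a b := by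
      intro a b e hm hlt
      have hsa := star_mem_orient (Q := Q) (mem_orient_self a)
      have := hF.star_rel_of_quotLT hs hLF hlt
        (hs.hypRel_trans (hs.hypRel_symm (hs.hypRel_of_mem_orient hsa)) e)
        (fun z hz h h' => hm z (hs.hypRel_trans e hz)
          ⟨_, hsa, z, mem_orient_self z, b, mem_orient_self b, h, h'⟩)
      rwa [Q.star_star] at this
    rintro ⟨h⟩ ⟨k⟩ e - hm a ha b hb hab
    rw [quot_hypRel hr hLF h₁] at e
    have hm' : ∀ m, Q.hypRel s h m → ¬ Q.QuotSeparates r m h k := fun m hm₁ hsep =>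
      hm (Quot.mk r m) ((quot_hypRel hr hLF h₁).2 hm₁) ((hr.quot_separates hLF).2 hsep)
    obtain ⟨a, ha', rfl⟩ : ∃ a' ∈ Q.orient h, a = Quot.mk r a' := by
      rcases ha with ha | ha
      exacts [⟨h, mem_orient_self h, ha⟩, ⟨_, star_mem_orient (mem_orient_self h), ha⟩]
    obtain ⟨b, hb', rfl⟩ : ∃ b' ∈ Q.orient k, b = Quot.mk r b' := by
      rcases hb with hb | hb
      exacts [⟨k, mem_orient_self k, hb⟩, ⟨_, star_mem_orient (mem_orient_self k), hb⟩]
    rw [h₁]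
    refine key a b (hs.hypRel_trans (hs.hypRel_symm (hs.hypRel_of_mem_orient ha'))
      (hs.hypRel_trans e (hs.hypRel_of_mem_orient hb'))) (fun m hm₁ hsep => ?_)
      ((hr.quot_facing hLF).1 hab)
    refine hm' m (hs.hypRel_trans (hs.hypRel_of_mem_orient ha') hm₁) ?_
    rwa [QuotSeparates, orient_congr ha', orient_congr hb'] at hsep

/-- The order on an iterated quotient. -/
theorem quot_quotLT (hF : Q.IsFoldOf s E r) (hs : Q.IsAdmissible s)
    (hLF : Q.LocallyFinite) (h₁ : ∀ a b, s₁ (Quot.mk r a) (Quot.mk r b) ↔ s a b) :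
    ((hF.isAdmissible hs hLF).quot hLF).QuotLT s₁ (Quot.mk r a) (Quot.mk r b) ↔
      Q.QuotLT s a b := by
  have hr := hF.isAdmissible hs hLF
  have hs₁ := hF.quot_isAdmissible hs hLF h₁
  constructor
  · intro hlt
    have hd : ∀ x y, s a x → s b y →
        (hr.quot hLF).disjointHyp (Quot.mk r x) (Quot.mk r y) := fun x y hx hy =>
      hlt.2.1 _ _ ((h₁ _ _).2 hx) ((h₁ _ _).2 hy)
    refine hs.quotLT_of_forall (fun e => hlt.1 ((h₁ a b).2 e)) (fun x y hx hy => ?_)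
      (fun x y hx hy hi => ?_)
    · have := hd x y hx hy
      rw [disjointHyp, hr.quot_sameHyp, hr.quot_transverse] at this
      exact ⟨fun e => this.1 (hr.hypRel_of_mem_orient e),
        fun e => this.2 (hr.quotTransverse_of_transverse hLF e)⟩
    · have hir : ∀ {x y}, Q.Insep s x y → Q.Insep r x y := fun hi m hm =>
        hi m (hm.imp (hF.hypRel_le hs) (hF.hypRel_le hs))
      refine hr.lt_of_quotLT ?_ (hir hi)
      rw [← hr.quot_lt hLF]
      refine hs₁.lt_of_quotLT (hs₁.quotLT_congr hlt ((h₁ _ _).2 hx) ((h₁ _ _).2 hy)) ?_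
      rintro ⟨m⟩ hm hsep
      rw [quot_hypRel hr hLF h₁, quot_hypRel hr hLF h₁] at hm
      obtain ⟨p, hp, q, hq, t, ht, hpq, hqt⟩ := (hr.quot_separates hLF).1 hsep
      obtain ⟨n, hqn, hpn, hnt⟩ := hr.exists_between_of_quotLT hLF hpq hqt
        (hir (hs.insep_congr hp ht hi))
      have hmn : Q.hypRel s m n :=
        hs.hypRel_trans (hs.hypRel_of_mem_orient hq) (Or.inl (hF.le hs hqn))
      exact hi n (hm.imp (fun h => hs.hypRel_trans h hmn) fun h => hs.hypRel_trans h hmn)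
        ⟨p, hp, n, mem_orient_self n, t, ht, hpn, hnt⟩
  · intro hlt
    obtain ⟨hne, hnt⟩ := hs.not_quotTransverse_of_quotLT hLF hlt
    refine hs₁.quotLT_of_forall (fun e => hlt.1 ((h₁ a b).1 e)) ?_ ?_
    · rintro ⟨x⟩ ⟨y⟩ hx hy
      rw [h₁] at hx hy
      obtain ⟨hne, hnt⟩ := hs.not_quotTransverse_of_quotLT hLF (hs.quotLT_congr hlt hx hy)
      refine ⟨fun e => hne (hF.hypRel_le hs ((hr.quot_sameHyp hLF).1 e)), fun e => hnt ?_⟩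
      exact hF.quotTransverse_le hs hLF ((hr.quot_transverse hLF).1 e)
    · rintro ⟨x⟩ ⟨y⟩ hx hy hi
      rw [h₁] at hx hy
      refine (hr.quot_lt hLF).2 (hF.quotLT_of_quotLT hs hLF hlt hx hy fun z hz hsep => ?_)
      refine hi (Quot.mk r z) ?_ ((hr.quot_separates hLF).2 hsep)
      rw [quot_hypRel hr hLF h₁, quot_hypRel hr hLF h₁]
      exact hz.imp (hs.hypRel_trans (Or.inl (hs.equiv.symm hx)))
        (hs.hypRel_trans (Or.inl (hs.equiv.symm hy)))

theorem quot_quotLE (hF : Q.IsFoldOf s E r) (hs : Q.IsAdmissible s)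
    (hLF : Q.LocallyFinite) (h₁ : ∀ a b, s₁ (Quot.mk r a) (Quot.mk r b) ↔ s a b) :
    ((hF.isAdmissible hs hLF).quot hLF).QuotLE s₁ (Quot.mk r a) (Quot.mk r b) ↔
      Q.QuotLE s a b :=
  or_congr (h₁ a b) (hF.quot_quotLT hs hLF h₁)

end IsFoldOf

/-! ### Elementary folds of resolutions -/

variable {f : P → P'} {h k m : P}

theorem IsAdmissibleMap.sameHyp_iff (hf : ∀ h, f (Q.star h) = Q'.star (f h)) :
    Q'.sameHyp (f h) (f k) ↔ Q.hypRel (simRel f) k h := by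
  simp only [sameHyp, hypRel, simRel, hf]

theorem IsAdmissible.facing_eq (hs : Q.IsAdmissible (simRel f))
    (hf : ∀ h, f (Q.star h) = Q'.star (f h)) (hhk : Q.facing h k) (e : Q'.sameHyp (f h) (f k))
    (hm : ∀ m, Q'.sameHyp (f m) (f h) → ¬ Q.separates m h k) : f h = f k := by
  simp only [IsAdmissibleMap.sameHyp_iff hf] at e hm
  refine hs.aer4 h k (hs.hypRel_symm e) ?_ hm h (mem_orient_self h) k (mem_orient_self k) hhk
  exact (disjointHyp_iff.2 (Or.inr (Or.inl hhk))).1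

section Action

variable {G : Type w} [Group G] [MulAction G P] [MulAction G P']

theorem IsGAction.smul_lt (hG : Q.IsGAction G) (g : G) {a b : P} (h : Q.lt a b) :
    Q.lt (g • a) (g • b) :=
  ⟨hG.smul_le g a b h.1, fun e => h.2 (MulAction.injective g e)⟩

theorem IsGAction.smul_mem_orient (hG : Q.IsGAction G) (g : G) {a b : P} (h : a ∈ Q.orient b) :
    g • a ∈ Q.orient (g • b) := by
  rcases h with rfl | rfl
  exacts [mem_orient_self _, Or.inr (hG.smul_star g b)]

theorem IsGAction.smul_separates (hG : Q.IsGAction G) (g : G) (hs : Q.separates m h k) :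
    Q.separates (g • m) (g • h) (g • k) := by
  obtain ⟨a, ha, b, hb, c, hc, hab, hbc⟩ := hs
  exact ⟨_, hG.smul_mem_orient g ha, _, hG.smul_mem_orient g hb, _, hG.smul_mem_orient g hc,
    hG.smul_lt g hab, hG.smul_lt g hbc⟩

theorem IsFoldRel.isFoldOf {h₁ h₂ : P} (hG : Q.IsGAction G)
    (hf : ∀ h, f (Q.star h) = Q'.star (f h)) (hequi : Equivariant G f)
    (hs : Q.IsAdmissible (simRel f)) (hfold : ElemFoldable Q Q' f h₁ h₂)
    (hrel : Q.IsFoldRel G h₁ h₂ r) :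
    Q.IsFoldOf (simRel f) (fun x y => ∃ g : G, x = g • h₁ ∧ y = g • h₂) r := by
  obtain ⟨hfac, heq, hins, hel⟩ := hfold
  simp only [IsAdmissibleMap.sameHyp_iff hf] at hins hel
  have smulRel : ∀ (g : G) {a b}, Q.hypRel (simRel f) a b →
      Q.hypRel (simRel f) (g • a) (g • b) := by
    intro g a b e
    simp only [hypRel, simRel, ← hG.smul_star, hequi g] at e ⊢
    exact e.imp (congrArg _) (congrArg _)
  have back : ∀ (g : G) {m}, Q.separates m (g • h₁) (g • h₂) →
      Q.separates (g⁻¹ • m) h₁ h₂ := by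
    intro g m h
    simpa only [inv_smul_smul] using hG.smul_separates g⁻¹ h
  refine ⟨hrel.equiv, hrel.sinv, ?_, ?_, ?_, ?_, ?_, ?_⟩
  · rintro _ _ ⟨g, rfl, rfl⟩
    exact hrel.ginv g _ _ hrel.base
  · rintro _ _ ⟨g, rfl, rfl⟩
    rw [← hG.smul_star]
    exact hG.smul_lt g hfac
  · rintro _ _ ⟨g, rfl, rfl⟩
    simp only [simRel, hequi g, heq]
  · rintro _ _ ⟨g, rfl, rfl⟩ m hm hsep
    refine hins (g⁻¹ • m) ?_ (back g hsep)
    simpa only [inv_smul_smul] using smulRel g⁻¹ hm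
  · rintro _ _ ⟨g, rfl, rfl⟩ m m' hm h h'
    by_contra hne
    refine hel (g⁻¹ • m) (g⁻¹ • m') (hs.hypRel_symm (smulRel g⁻¹ hm)) (fun e => hne ?_)
      ⟨back g h, back g h'⟩
    have : m' ∈ Q.orient m := by simpa only [smul_inv_smul] using hG.smul_mem_orient g e
    exact this
  · intro t ht hE a b hab
    have := hrel.min (fun a b => ∀ g : G, t (g • a) (g • b) ∧
        t (Q.star (g • a)) (Q.star (g • b)))
      ⟨fun a g => ⟨ht.refl _, ht.refl _⟩, fun h g => ⟨ht.symm (h g).1, ht.symm (h g).2⟩,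
        fun h h' g => ⟨ht.trans (h g).1 (h' g).1, ht.trans (h g).2 (h' g).2⟩⟩
      (fun g a b h g' => by simpa only [mul_smul] using h (g' * g))
      (fun a b h g => by simpa only [hG.smul_star, Q.star_star] using (h g).symm)
      (fun g => hE _ _ ⟨g, rfl, rfl⟩) a b hab 1
    simpa only [one_smul] using this.1

end Action

end Pocset

/-- after an elementary fold `φ : P → P/∼` of a `G`-equivariant
resolution `f₀`, the induced map `f₁ : P/∼ → P'` (with `f₀ = f₁ ∘ φ`) is
admissible, `(P/∼)/∼_{f₁}` is isomorphic as a pocset to `P/∼_{f₀}` via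
`[h]_{∼_{f₁}} ↦ [h]_{∼_{f₀}}`, and `f₁` is a `G`-equivariant resolution. -/
theorem elementary_fold_factorization {P : Type u} {P' : Type v}
    (Q : Pocset P) (Q' : Pocset P')
    (hLF : Q.LocallyFinite) (hLF' : Q'.LocallyFinite)
    (G : Type w) [Group G] [MulAction G P] [MulAction G P']
    (hG : Q.IsGAction G) (hG' : Q'.IsGAction G)
    (f₀ : P → P') (hres : Pocset.IsResolution Q Q' f₀)
    (hequi : Pocset.Equivariant G f₀)
    (h₁ h₂ : P) (hfold : Pocset.ElemFoldable Q Q' f₀ h₁ h₂)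
    (r : P → P → Prop) (hrel : Q.IsFoldRel G h₁ h₂ r) :
    ∃ Qr : Pocset (Quot r),
      (∀ a b : P, Qr.le (Quot.mk r a) (Quot.mk r b) ↔ Q.QuotLE r a b) ∧
      (∀ a : P, Qr.star (Quot.mk r a) = Quot.mk r (Q.star a)) ∧
      ∀ f₁ : Quot r → P', (∀ a : P, f₁ (Quot.mk r a) = f₀ a) →
        Pocset.IsAdmissibleMap Qr Q' f₁ ∧
        (∀ a b : P,
          Qr.QuotLE (Pocset.simRel f₁) (Quot.mk r a) (Quot.mk r b) ↔
            Q.QuotLE (Pocset.simRel f₀) a b) ∧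
        Pocset.IsResolution Qr Q' f₁ ∧
        (∀ (g : G) (a : P), f₁ (Quot.mk r (g • a)) = g • f₁ (Quot.mk r a)) := by
  have hf := hres.adm.am1
  have hs := hres.aer
  have hF := Pocset.IsFoldRel.isFoldOf hG hf hequi hs hfold hrel
  have hr := hF.isAdmissible hs hLF
  refine ⟨hr.quot hLF, fun a b => Iff.rfl, fun a => rfl, fun f₁ hf₁ => ?_⟩
  have h₁ : ∀ a b, Pocset.simRel f₁ (Quot.mk r a) (Quot.mk r b) ↔ Pocset.simRel f₀ a b :=
    fun a b => by simp only [Pocset.simRel, hf₁]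
  have hs₁ := hF.quot_isAdmissible hs hLF h₁
  have am1 : ∀ h, f₁ ((hr.quot hLF).star h) = Q'.star (f₁ h) := by
    rintro ⟨h⟩
    exact (hf₁ _).trans ((hf h).trans (congrArg Q'.star (hf₁ h).symm))
  have hLE : ∀ a b, (hr.quot hLF).QuotLE (Pocset.simRel f₁) (Quot.mk r a) (Quot.mk r b) ↔
      Q.QuotLE (Pocset.simRel f₀) a b := fun a b => hF.quot_quotLE hs hLF h₁
  have hT : ∀ h k, Q.QuotTransverse (Pocset.simRel f₀) h k → Q'.transverse (f₀ h) (f₀ k) :=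
    hres.quot_am2
  have hadm : Pocset.IsAdmissibleMap (hr.quot hLF) Q' f₁ := by
    refine ⟨am1, ?_, fun h k hhk e hm => hs₁.facing_eq am1 hhk e hm, fun h' hh' => ?_⟩
    · rintro ⟨h⟩ ⟨k⟩ ht
      rw [hf₁, hf₁]
      exact hT h k (hF.quotTransverse_le hs hLF ((hr.quot_transverse hLF).1 ht))
    · obtain ⟨b, hb, hcomp⟩ := hres.adm.am4 h' fun m => by
        rw [← hf₁]
        exact hh' (Quot.mk r m)
      refine ⟨b, hb, ?_⟩
      rintro ⟨m⟩
      rw [hf₁]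
      exact hcomp m
  refine ⟨hadm, hLE, ⟨hadm, hs₁, ?_, ?_, ?_⟩, fun g a => ?_⟩
  · rintro ⟨h⟩ ⟨k⟩ ht
    rw [hf₁, hf₁]
    refine hT h k ?_
    simpa only [Pocset.QuotTransverse, Pocset.IsFoldOf.quot_hypRel hr hLF h₁, Pocset.mem_orient,
      forall_eq_or_imp, forall_eq, hr.quot_star, hLE] using ht
  · rintro ⟨h⟩ ⟨k⟩ hhk e hm
    rw [hf₁, hf₁] at e ⊢
    refine hres.quot_am3 h k ((hF.quot_quotLT hs hLF h₁).1 hhk) e fun m hme hsep => ?_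
    refine hm (Quot.mk r m) (by rwa [hf₁, hf₁]) ?_
    simpa only [Pocset.QuotSeparates, Pocset.mem_orient, exists_eq_or_imp, exists_eq_left,
      hr.quot_star, hF.quot_quotLT hs hLF h₁] using hsep
  · rintro ⟨h⟩ ⟨k⟩ hle
    rw [hf₁, hf₁] at hle
    exact (hLE h k).2 (hres.le_reflect h k hle)
  · rw [hf₁, hf₁, hequi g a]
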